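/- arXiv:2206.09493 — 14 statements merged into one kernel-verified Lean document; each statement's English description precedes it below -/
import Mathlib

section
/- Let f be a nonconstant polynomial with complex coefficients such that f(x) divides f(x^n) in ℂ[X] for every positive integer n. Then every root ζ of f is either 0 or a root of unity, i.e., ζ = 0 or ζ^k = 1 for some positive integer k. -/
open Polynomial

/-- Every root of a nonconstant divisibility polynomial is zero or a root
of unity. -/
theorem stmt_1 (f : Polynomial ℂ) (hf : 0 < f.natDegree)
    (hdiv : ∀ n : ℕ, 0 < n → f ∣ f.comp (X ^ n)) :
    ∀ ζ : ℂ, f.IsRoot ζ → ζ = 0 ∨ ∃ k : ℕ, 0 < k ∧ ζ ^ k = 1 := by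
  intro ζ hζ
  have hf0 : f ≠ 0 := ne_zero_of_natDegree_gt hf
  have hroot : ∀ n : ℕ, ζ ^ (n + 1) ∈ f.rootSet ℂ := fun n ↦ by
    have h := hζ.dvd (hdiv (n + 1) n.succ_pos)
    rw [mem_rootSet_of_ne hf0, coe_aeval_eq_eval]
    simpa [IsRoot, eval_comp] using h
  obtain ⟨m, n, hmn, heq⟩ :=
    (f.rootSet_finite ℂ).exists_lt_map_eq_of_forall_mem hroot
  refine or_iff_not_imp_left.2 fun h0 ↦ ⟨n - m, Nat.sub_pos_of_lt hmn, ?_⟩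
  refine mul_left_cancel₀ (pow_ne_zero (m + 1) h0) ?_
  rw [← pow_add, mul_one, heq]
  congr 1
  omega
end

section
/- Let f be a monic divisibility polynomial with complex coefficients and nonzero constant term. Then there exists an order-reversing multiplicity map λ such that f(x) = ∏_{h≥1} Φ_h(x)^{λ(h)}, where Φ_h is the h-th cyclotomic polynomial. -/
open Polynomial

/-- Substituting `X ^ n` does not increase root multiplicities at nonzero points. -/
theorem rootMultiplicity_comp_X_pow_le {f : ℂ[X]} (hf : f ≠ 0) {n : ℕ} (hn : 0 < n) {z : ℂ}
    (hz : z ≠ 0) :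
    rootMultiplicity z (f.comp (X ^ n)) ≤ rootMultiplicity (z ^ n) f := by
  obtain ⟨g, hfg, hg⟩ := exists_eq_pow_rootMultiplicity_mul_and_not_dvd f hf (z ^ n)
  set m := rootMultiplicity (z ^ n) f
  have hgz : (g.comp (X ^ n)).eval z ≠ 0 := by
    rw [dvd_iff_isRoot, IsRoot.def] at hg
    simpa [eval_comp] using hg
  have hgn : g.comp (X ^ n) ≠ 0 := fun h => hgz (by simp [h])
  have hsub : (X ^ n - C (z ^ n) : ℂ[X]) ≠ 0 := X_pow_sub_C_ne_zero hn _
  have hsep : (X ^ n - C (z ^ n) : ℂ[X]).Separable :=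
    separable_X_pow_sub_C _ (by exact_mod_cast hn.ne') (pow_ne_zero _ hz)
  have hle := rootMultiplicity_le_one_of_separable hsep z
  have hcomp : f.comp (X ^ n) = (X ^ n - C (z ^ n)) ^ m * g.comp (X ^ n) := by
    conv_lhs => rw [hfg]
    simp
  have hroot : rootMultiplicity z (g.comp (X ^ n)) = 0 := rootMultiplicity_eq_zero hgz
  rw [hcomp, rootMultiplicity_mul (mul_ne_zero (pow_ne_zero _ hsub) hgn), hroot, add_zero,
    ← count_roots, roots_pow, Multiset.count_nsmul, count_roots]
  simpa using Nat.mul_le_mul_left m hle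

theorem rootMultiplicity_le_rootMultiplicity_pow {f : ℂ[X]} (hf : f ≠ 0) {n : ℕ} (hn : 0 < n)
    (hdiv : f ∣ f.comp (X ^ n)) {z : ℂ} (hz : z ≠ 0) :
    rootMultiplicity z f ≤ rootMultiplicity (z ^ n) f := by
  refine le_trans (rootMultiplicity_le_rootMultiplicity_of_dvd ?_ hdiv z)
    (rootMultiplicity_comp_X_pow_le hf hn hz)
  rw [← expand_eq_comp_X_pow]
  exact (expand_ne_zero hn).2 hf

/-- A root of a polynomial whose root set is closed under positive powers has finite order. -/
theorem orderOf_pos_of_forall_pow_isRoot {f : ℂ[X]} (hf : f ≠ 0) {z : ℂ} (hz : z ≠ 0)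
    (h : ∀ n : ℕ, 0 < n → f.IsRoot (z ^ n)) : 0 < orderOf z := by
  by_contra h0
  have h0 : orderOf z = 0 := by omega
  have hinj : Function.Injective fun n : ℕ => z ^ (n + 1) := by
    intro a b hab
    have key : ∀ a b : ℕ, a < b → z ^ (a + 1) ≠ z ^ (b + 1) := by
      intro a b hlt heq
      refine orderOf_eq_zero_iff'.1 h0 (b - a) (by omega) ?_
      have : z ^ (a + 1) * z ^ (b - a) = z ^ (a + 1) * 1 := by
        rw [← pow_add, mul_one, heq]; congr 1; omega
      exact mul_left_cancel₀ (pow_ne_zero _ hz) this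
    rcases lt_trichotomy a b with hlt | rfl | hlt
    · exact absurd hab (key a b hlt)
    · rfl
    · exact absurd hab.symm (key b a hlt)
  refine Set.infinite_range_of_injective hinj ((finite_setOfPred_isRoot hf).subset ?_)
  rintro _ ⟨n, rfl⟩
  exact h (n + 1) n.succ_pos

theorem count_roots_cyclotomic {h : ℕ} (hh : 0 < h) (z : ℂ) :
    (cyclotomic h ℂ).roots.count z = if orderOf z = h then 1 else 0 := by
  have : NeZero (h : ℂ) := ⟨by exact_mod_cast hh.ne'⟩
  rw [Multiset.count_eq_of_nodup roots_cyclotomic_nodup]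
  simp only [mem_roots (cyclotomic_ne_zero h ℂ), isRoot_cyclotomic_iff,
    IsPrimitiveRoot.iff_orderOf]

/-- A monic divisibility polynomial with nonzero constant term is the product
`∏_{h ≥ 1} Φ_h(x)^{λ(h)}` for some order-reversing multiplicity map `λ`. -/
theorem stmt_2 (f : Polynomial ℂ) (hmonic : f.Monic) (hconst : f.coeff 0 ≠ 0)
    (hdiv : ∀ n : ℕ, 0 < n → f ∣ f.comp (X ^ n)) :
    ∃ lam : ℕ → ℕ, lam 0 = 0 ∧ {h | lam h ≠ 0}.Finite ∧
      (∀ h h' : ℕ, 0 < h → h ∣ h' → lam h' ≤ lam h) ∧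
      f = ∏ᶠ h : ℕ, (cyclotomic h ℂ) ^ (lam h) := by
  classical
  have hf : f ≠ 0 := hmonic.ne_zero
  have hpow : ∀ z : ℂ, z ≠ 0 → ∀ n : ℕ, 0 < n →
      rootMultiplicity z f ≤ rootMultiplicity (z ^ n) f := fun z hz n hn =>
    rootMultiplicity_le_rootMultiplicity_pow hf hn (hdiv n hn) hz
  have hzero : rootMultiplicity 0 f = 0 :=
    rootMultiplicity_eq_zero (by rwa [IsRoot.def, ← coeff_zero_eq_eval_zero])
  let ζ : ℕ → ℂ := fun h => Complex.exp (2 * Real.pi * Complex.I / h)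
  have hζ : ∀ h : ℕ, h ≠ 0 → IsPrimitiveRoot (ζ h) h := fun h hh => Complex.isPrimitiveRoot_exp h hh
  have hprim : ∀ (h h' : ℕ), h ≠ 0 → h' ≠ 0 → h ∣ h' → ∀ z w : ℂ, IsPrimitiveRoot z h' →
      IsPrimitiveRoot w h → rootMultiplicity z f ≤ rootMultiplicity w f := by
    rintro h _ hh hh' ⟨k, rfl⟩ z w hz hw
    have hk : k ≠ 0 := right_ne_zero_of_mul hh'
    have hzk : IsPrimitiveRoot (z ^ k) h := hz.pow (Nat.pos_of_ne_zero hh') (mul_comm h k)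
    have : NeZero h := ⟨hh⟩
    obtain ⟨i, -, rfl⟩ := hzk.eq_pow_of_pow_eq_one hw.pow_eq_one
    have hz0 : z ≠ 0 := hz.ne_zero hh'
    refine (hpow z hz0 (k * (i + h)) (by positivity)).trans_eq ?_
    rw [pow_mul, pow_add, hzk.pow_eq_one, mul_one]
  let lam : ℕ → ℕ := fun h => if h = 0 then 0 else rootMultiplicity (ζ h) f
  have hlam : ∀ h, h ≠ 0 → lam h = rootMultiplicity (ζ h) f := fun h hh => if_neg hh
  have hlam0 : lam 0 = 0 := if_pos rfl
  have hmul : ∀ z : ℂ, rootMultiplicity z f = lam (orderOf z) := by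
    intro z
    by_cases ho : orderOf z = 0
    · rw [ho, hlam0]
      by_contra hne
      have hz : z ≠ 0 := by
        rintro rfl
        exact hne hzero
      refine (orderOf_pos_of_forall_pow_isRoot hf hz fun n hn => ?_).ne' ho
      exact (rootMultiplicity_pos hf).1 ((Nat.pos_of_ne_zero hne).trans_le (hpow z hz n hn))
    · rw [hlam _ ho]
      have hz := IsPrimitiveRoot.orderOf z
      exact le_antisymm (hprim _ _ ho ho dvd_rfl _ _ hz (hζ _ ho))
        (hprim _ _ ho ho dvd_rfl _ _ (hζ _ ho) hz)
  have hfin : {h | lam h ≠ 0}.Finite := by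
    refine ((finite_setOfPred_isRoot hf).image orderOf).subset fun h hh => ?_
    have h0 : h ≠ 0 := by
      rintro rfl
      exact hh hlam0
    refine ⟨ζ h, ?_, (hζ h h0).eq_orderOf.symm⟩
    rw [Set.mem_ofPred_eq, hlam h h0] at hh
    exact (rootMultiplicity_pos hf).1 (Nat.pos_of_ne_zero hh)
  refine ⟨lam, hlam0, hfin, fun h h' hh hdvd => ?_, ?_⟩
  · by_cases hh' : h' = 0
    · simp [hh', hlam0]
    · rw [hlam h hh.ne', hlam h' hh']
      exact hprim h h' hh.ne' hh' hdvd _ _ (hζ h' hh') (hζ h hh.ne')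
  · rw [finprod_eq_prod_of_mulSupport_subset (s := hfin.toFinset) _ (by
      intro h hh
      simp only [Set.Finite.coe_toFinset, Set.mem_ofPred_eq]
      intro h0
      simp [h0] at hh)]
    have hP : (∏ h ∈ hfin.toFinset, cyclotomic h ℂ ^ lam h).Monic :=
      monic_prod_of_monic _ _ fun h _ => (cyclotomic.monic h ℂ).pow _
    rw [(IsAlgClosed.splits f).eq_prod_roots_of_monic hmonic,
      (IsAlgClosed.splits (∏ h ∈ hfin.toFinset, cyclotomic h ℂ ^ lam h)).eq_prod_roots_of_monic hP]
    congr 2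
    ext z
    rw [count_roots, hmul, roots_prod _ _ hP.ne_zero]
    change _ = Multiset.count z (∑ h ∈ hfin.toFinset, (cyclotomic h ℂ ^ lam h).roots)
    rw [Multiset.count_sum']
    have hterm : ∀ h ∈ hfin.toFinset, (cyclotomic h ℂ ^ lam h).roots.count z =
        if orderOf z = h then lam h else 0 := by
      intro h hh
      have h0 : h ≠ 0 := by
        rintro rfl
        exact (hfin.mem_toFinset.1 hh) hlam0
      rw [roots_pow, Multiset.count_nsmul, count_roots_cyclotomic (Nat.pos_of_ne_zero h0)]
      simp
    rw [Finset.sum_congr rfl hterm, Finset.sum_ite_eq]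
    split_ifs with hmem
    · rfl
    · simpa using hmem
end

section
/- Let λ be an order-reversing multiplicity map. Then the polynomial Φ_λ(x) := ∏_{h≥1} Φ_h(x)^{λ(h)} is a divisibility polynomial, i.e., Φ_λ(x) divides Φ_λ(x^n) in ℂ[X] for every positive integer n. -/
open Polynomial

/-- If `ζ` is a primitive `k`-th root of unity then `ζ ^ n` is a primitive root of order
`k / gcd k n`, so `Φ_k(x)` divides `Φ_{k / gcd k n}(x ^ n)`. -/
lemma cyclotomic_dvd_cyclotomic_div_gcd_comp_X_pow {k : ℕ} (hk : 0 < k) (n : ℕ)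
    (R : Type*) [CommRing R] :
    cyclotomic k R ∣ (cyclotomic (k / k.gcd n) R).comp (X ^ n) := by
  have key : cyclotomic k ℤ ∣ (cyclotomic (k / k.gcd n) ℤ).comp (X ^ n) := by
    have hζ := Complex.isPrimitiveRoot_exp k hk.ne'
    set ζ := Complex.exp (2 * Real.pi * Complex.I / k)
    have hpow : IsPrimitiveRoot (ζ ^ n) (k / k.gcd n) := by
      have h := IsPrimitiveRoot.orderOf (ζ ^ n)
      rwa [(hζ.isOfFinOrder hk.ne').orderOf_pow, ← hζ.eq_orderOf] at h
    have hpos : 0 < k / k.gcd n :=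
      Nat.div_pos (Nat.gcd_le_left n hk) (Nat.gcd_pos_of_pos_left n hk)
    rw [cyclotomic_eq_minpoly hζ hk]
    apply minpoly.isIntegrallyClosed_dvd (hζ.isIntegral hk)
    rw [aeval_comp, map_pow, aeval_X, aeval_def, eval₂_eq_eval_map, algebraMap_int_eq,
      map_cyclotomic]
    exact hpow.isRoot_cyclotomic hpos
  simpa [Polynomial.map_comp] using Polynomial.map_dvd (Int.castRingHom R) key

/-- For any order-reversing multiplicity map `λ`, the polynomial
`Φ_λ(x) = ∏_{h ≥ 1} Φ_h(x)^{λ(h)}` is a divisibility polynomial. -/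
theorem stmt_3 (lam : ℕ → ℕ) (h0 : lam 0 = 0) (hfin : {h | lam h ≠ 0}.Finite)
    (hord : ∀ h h' : ℕ, 0 < h → h ∣ h' → lam h' ≤ lam h) :
    ∀ n : ℕ, 0 < n →
      (∏ᶠ h : ℕ, (cyclotomic h ℂ) ^ (lam h)) ∣
        (∏ᶠ h : ℕ, (cyclotomic h ℂ) ^ (lam h)).comp (X ^ n) := by
  intro n _
  have hprod : (∏ᶠ h : ℕ, (cyclotomic h ℂ) ^ (lam h)) =
      ∏ h ∈ hfin.toFinset, (cyclotomic h ℂ) ^ (lam h) := by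
    apply finprod_eq_prod_of_mulSupport_subset
    intro h hh
    simp only [Set.Finite.coe_toFinset, Set.mem_ofPred_eq]
    intro hz
    simp [hz] at hh
  rw [hprod, prod_comp]
  apply Finset.prod_dvd_of_coprime
  · intro a _ b _ hab
    have hcop := (cyclotomic.isCoprime_rat hab).map (mapRingHom (algebraMap ℚ ℂ))
    simp only [coe_mapRingHom, map_cyclotomic] at hcop
    exact hcop.pow
  · intro k hk
    have hlam : lam k ≠ 0 := by simpa using hk
    have hkpos : 0 < k := Nat.pos_of_ne_zero fun h => hlam (h ▸ h0)
    have hle : lam k ≤ lam (k / k.gcd n) :=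
      hord _ _ (Nat.div_pos (Nat.gcd_le_left n hkpos) (Nat.gcd_pos_of_pos_left n hkpos))
        (Nat.div_dvd_of_dvd (Nat.gcd_dvd_left k n))
    have hmem : k / k.gcd n ∈ hfin.toFinset := by
      simp only [Set.Finite.mem_toFinset, Set.mem_ofPred_eq]
      omega
    refine dvd_trans ?_ (Finset.dvd_prod_of_mem _ hmem)
    rw [pow_comp]
    exact (pow_dvd_pow_of_dvd (cyclotomic_dvd_cyclotomic_div_gcd_comp_X_pow hkpos n ℂ) _).trans
      (pow_dvd_pow _ hle)
end

section
/- Let λ be a nonzero order-reversing multiplicity map and Φ_λ := ∏_{h≥1} Φ_h^{λ(h)}. Then Φ_λ is indecomposable (i.e., it cannot be written as a product of two nonconstant divisibility polynomials) if and only if λ(1) = 1, i.e., if and only if every cyclotomic factor of Φ_λ has multiplicity at most 1. -/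
open Polynomial

/-- A complex polynomial `f` is a divisibility polynomial if `f(x) ∣ f(xⁿ)` for all `n ≥ 1`. -/
def IsDivPoly (f : Polynomial ℂ) : Prop := ∀ n : ℕ, 0 < n → f ∣ f.comp (X ^ n)

theorem IsDivPoly.one : IsDivPoly 1 := fun n _ => by simp

theorem IsDivPoly.mul {f g : ℂ[X]} (hf : IsDivPoly f) (hg : IsDivPoly g) : IsDivPoly (f * g) :=
  fun n hn => by
    rw [mul_comp]
    exact mul_dvd_mul (hf n hn) (hg n hn)

theorem IsDivPoly.prod {ι : Type*} (s : Finset ι) (f : ι → ℂ[X]) (h : ∀ i ∈ s, IsDivPoly (f i)) :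
    IsDivPoly (∏ i ∈ s, f i) :=
  Finset.prod_induction f IsDivPoly (fun _ _ => IsDivPoly.mul) IsDivPoly.one h

theorem cyclotomic_rat_dvd_cyclotomic_comp_X_pow {d n : ℕ} (hd : 0 < d) (hn : n ≠ 0) :
    cyclotomic d ℚ ∣ (cyclotomic (d / d.gcd n) ℚ).comp (X ^ n) := by
  have hz := Complex.isPrimitiveRoot_exp d hd.ne'
  rw [cyclotomic_eq_minpoly_rat hz hd]
  apply minpoly.dvd
  have hg : 0 < d.gcd n := Nat.gcd_pos_of_pos_left n hd
  have hdiv : 0 < d / d.gcd n := Nat.div_pos (Nat.gcd_le_left n hd) hg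
  have hp : IsPrimitiveRoot (Complex.exp (2 * Real.pi * Complex.I / d) ^ n) (d / d.gcd n) := by
    have h := IsPrimitiveRoot.orderOf (Complex.exp (2 * Real.pi * Complex.I / d) ^ n)
    rwa [orderOf_pow' _ hn, ← hz.eq_orderOf] at h
  rw [aeval_comp, map_pow, aeval_X, aeval_def, ← eval_map, map_cyclotomic]
  exact hp.isRoot_cyclotomic hdiv

theorem cyclotomic_dvd_cyclotomic_comp_X_pow {d n : ℕ} (hd : 0 < d) (hn : n ≠ 0) :
    cyclotomic d ℂ ∣ (cyclotomic (d / d.gcd n) ℂ).comp (X ^ n) := by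
  have h := Polynomial.map_dvd (algebraMap ℚ ℂ)
    (cyclotomic_rat_dvd_cyclotomic_comp_X_pow hd hn)
  simpa [Polynomial.map_comp] using h

theorem isCoprime_cyclotomic_complex {m n : ℕ} (h : m ≠ n) :
    IsCoprime (cyclotomic m ℂ) (cyclotomic n ℂ) := by
  simpa using (cyclotomic.isCoprime_rat h).map (mapRingHom (algebraMap ℚ ℂ))

/-- The product of the cyclotomic polynomials over a finite divisor-closed set of positive integers
is a divisibility polynomial. -/
theorem isDivPoly_prod_cyclotomic (s : Finset ℕ) (hpos : ∀ d ∈ s, 0 < d)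
    (hs : ∀ d ∈ s, ∀ e, e ∣ d → e ∈ s) : IsDivPoly (∏ d ∈ s, cyclotomic d ℂ) := by
  intro n hn
  refine Finset.prod_dvd_of_coprime (fun a _ b _ hab => isCoprime_cyclotomic_complex hab)
    fun d hd => ?_
  refine (cyclotomic_dvd_cyclotomic_comp_X_pow (hpos d hd) hn.ne').trans ?_
  rw [prod_comp]
  exact Finset.dvd_prod_of_mem (fun e => (cyclotomic e ℂ).comp (X ^ n))
    (hs d hd _ (Nat.div_dvd_of_dvd (Nat.gcd_dvd_left d n)))

/-- A nonconstant divisibility polynomial dividing a product of powers of cyclotomic polynomials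
vanishes at `1`. -/
theorem IsDivPoly.isRoot_one {g : ℂ[X]} (hg : IsDivPoly g) (hdeg : 0 < g.natDegree)
    {s : Finset ℕ} (hpos : ∀ d ∈ s, 0 < d) {lam : ℕ → ℕ}
    (hdvd : g ∣ ∏ d ∈ s, cyclotomic d ℂ ^ lam d) : g.IsRoot 1 := by
  obtain ⟨z, hz⟩ := IsAlgClosed.exists_root g (natDegree_pos_iff_degree_pos.1 hdeg).ne'
  have hz' := hz.dvd hdvd
  rw [IsRoot.def, eval_prod, Finset.prod_eq_zero_iff] at hz'
  obtain ⟨d, hd, hzd⟩ := hz'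
  rw [eval_pow] at hzd
  have hd0 := hpos d hd
  have : NeZero (d : ℂ) := ⟨by exact_mod_cast hd0.ne'⟩
  have hprim : IsPrimitiveRoot z d := isRoot_cyclotomic_iff.1 (eq_zero_of_pow_eq_zero hzd)
  have h1 := hz.dvd (hg d hd0)
  rwa [IsRoot.def, eval_comp, eval_pow, eval_X, hprim.pow_eq_one] at h1

/-- For a nonzero order-reversing multiplicity map `λ`, the divisibility
polynomial `Φ_λ = ∏_h Φ_h^{λ(h)}` is indecomposable (not a product of two nonconstant
divisibility polynomials) iff `λ(1) = 1`. -/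
theorem stmt_5 (lam : ℕ → ℕ) (h0 : lam 0 = 0) (hfin : {h | lam h ≠ 0}.Finite)
    (hord : ∀ h h' : ℕ, 0 < h → h ∣ h' → lam h' ≤ lam h) (hne : lam ≠ 0) :
    (¬ ∃ g h : Polynomial ℂ, IsDivPoly g ∧ IsDivPoly h ∧
        0 < g.natDegree ∧ 0 < h.natDegree ∧
        (∏ᶠ d : ℕ, (cyclotomic d ℂ) ^ (lam d)) = g * h) ↔ lam 1 = 1 := by
  set s := hfin.toFinset with hs
  have hmem : ∀ d, d ∈ s ↔ lam d ≠ 0 := by simp [hs]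
  have hpos : ∀ d ∈ s, 0 < d := fun d hd =>
    Nat.pos_of_ne_zero fun h => (hmem d).1 hd (h ▸ h0)
  have hle : ∀ d, lam d ≤ lam 1 := fun d => hord 1 d one_pos (one_dvd d)
  have h1 : lam 1 ≠ 0 := fun h => hne (funext fun d => Nat.le_zero.1 (h ▸ hle d))
  have hprod : (∏ᶠ d : ℕ, (cyclotomic d ℂ) ^ (lam d)) = ∏ d ∈ s, cyclotomic d ℂ ^ lam d := by
    refine finprod_eq_prod_of_mulSupport_subset _ fun d hd => ?_
    rw [Finset.mem_coe, hmem]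
    intro h
    exact hd (by simp [h])
  rw [hprod]
  constructor
  · intro hindec
    by_contra hne1
    obtain ⟨m, hm⟩ : ∃ m, lam 1 = m + 1 + 1 := ⟨lam 1 - 2, by omega⟩
    let L : ℕ → ℂ[X] := fun k => ∏ d ∈ s with k < lam d, cyclotomic d ℂ
    have hL : ∀ k, IsDivPoly (L k) := fun k => by
      refine isDivPoly_prod_cyclotomic _ (fun d hd => hpos d (Finset.mem_filter.1 hd).1) ?_
      intro d hd e hed
      rw [Finset.mem_filter] at hd ⊢
      have := hord e d (Nat.pos_of_dvd_of_pos hed (hpos d hd.1)) hed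
      exact ⟨(hmem e).2 (by omega), by omega⟩
    have hX : ∀ k < lam 1, X - C 1 ∣ L k := fun k hk => by
      have h1k : 1 ∈ {d ∈ s | k < lam d} := Finset.mem_filter.2 ⟨(hmem 1).2 h1, hk⟩
      have hdvd := Finset.dvd_prod_of_mem (fun d => cyclotomic d ℂ) h1k
      rwa [cyclotomic_one, ← C_1] at hdvd
    have hL0 : ∀ k, L k ≠ 0 := fun k =>
      Finset.prod_ne_zero_iff.2 fun d _ => cyclotomic_ne_zero d ℂ
    have hdeg : ∀ f : ℂ[X], f ≠ 0 → X - C 1 ∣ f → 0 < f.natDegree := fun f hf hd => by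
      have := natDegree_le_of_dvd hd hf
      rw [natDegree_X_sub_C] at this
      omega
    refine hindec ⟨L 0, ∏ k ∈ Finset.range (m + 1), L (k + 1), hL 0,
      IsDivPoly.prod _ _ fun k _ => hL _, hdeg _ (hL0 0) (hX 0 (by omega)),
      hdeg _ (Finset.prod_ne_zero_iff.2 fun k _ => hL0 _) ?_, ?_⟩
    · exact (hX 1 (by omega)).trans
        (Finset.dvd_prod_of_mem (fun k => L (k + 1)) (Finset.mem_range.2 m.succ_pos))
    · rw [mul_comm, ← Finset.prod_range_succ', ← hm]
      simp only [L, Finset.prod_filter]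
      rw [Finset.prod_comm]
      refine Finset.prod_congr rfl fun d _ => ?_
      have hfilter : {k ∈ Finset.range (lam 1) | k < lam d} = Finset.range (lam d) := by
        ext k
        have := hle d
        simp only [Finset.mem_filter, Finset.mem_range]
        omega
      rw [← Finset.prod_filter, hfilter, Finset.prod_const, Finset.card_range]
  · rintro hlam ⟨g, h, hg, hh, hgd, hhd, heq⟩
    have hg1 := dvd_iff_isRoot.2 (hg.isRoot_one hgd hpos (Dvd.intro _ heq.symm))
    have hh1 := dvd_iff_isRoot.2 (hh.isRoot_one hhd hpos (Dvd.intro_left _ heq.symm))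
    have hsq := mul_dvd_mul hg1 hh1
    rw [← heq, ← Finset.mul_prod_erase s _ ((hmem 1).2 h1), hlam, pow_one, cyclotomic_one, ← C_1,
      mul_dvd_mul_iff_left (X_sub_C_ne_zero (1 : ℂ)), dvd_iff_isRoot, IsRoot.def, eval_prod,
      Finset.prod_eq_zero_iff] at hsq
    obtain ⟨d, hd, hroot⟩ := hsq
    rw [Finset.mem_erase] at hd
    rw [eval_pow] at hroot
    have : NeZero (d : ℂ) := ⟨by exact_mod_cast (hpos d hd.2).ne'⟩
    have hprim : IsPrimitiveRoot (1 : ℂ) d :=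
      isRoot_cyclotomic_iff.1 (eq_zero_of_pow_eq_zero hroot)
    exact hd.1 (hprim.unique IsPrimitiveRoot.one)
end

section
/- Let n be a positive integer and Λ a nonempty finite saturated subset of the positive integers. Then ∏_{d∈Λ} Φ_d(x^n) = ∏_{e ∈ ⟨n⟩Λ} Φ_e(x), where ⟨n⟩Λ := {d·e : d divides n, e ∈ Λ} and each cyclotomic polynomial Φ_e appears exactly once in the product on the right. -/
open Polynomial

open scoped Pointwise in
/-- Expansion by a prime of the cyclotomic product over a divisor-closed finite set. -/
theorem prod_expand_prime_cyclotomic (R : Type*) [CommRing R] {p : ℕ} (hp : p.Prime)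
    (S : Finset ℕ) (hS : ∀ h ∈ S, ∀ d, d ∣ h → d ∈ S) :
    ∏ d ∈ S, expand R p (cyclotomic d R) = ∏ e ∈ p.divisors * S, cyclotomic e R := by
  have hunion : p.divisors * S = S.image (· * p) ∪ S.filter (¬ p ∣ ·) := by
    ext x
    simp only [Finset.mem_mul, Finset.mem_union, Finset.mem_image, Finset.mem_filter,
      hp.divisors, Finset.mem_insert, Finset.mem_singleton]
    constructor
    · rintro ⟨c, rfl | rfl, e, he, rfl⟩
      · by_cases h : p ∣ e
        · obtain ⟨k, rfl⟩ := h
          exact .inl ⟨k, hS _ he k (Dvd.intro_left _ rfl), by ring⟩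
        · exact .inr (by simpa using ⟨he, h⟩)
      · exact .inl ⟨e, he, mul_comm _ _⟩
    · rintro (⟨e, he, rfl⟩ | ⟨hx, -⟩)
      · exact ⟨p, .inr rfl, e, he, mul_comm _ _⟩
      · exact ⟨1, .inl rfl, x, hx, one_mul _⟩
  have hdisj : Disjoint (S.image (· * p)) (S.filter (¬ p ∣ ·)) := by
    rw [Finset.disjoint_left]
    intro x hx hx'
    obtain ⟨e, -, rfl⟩ := Finset.mem_image.1 hx
    exact (Finset.mem_filter.1 hx').2 (Dvd.intro_left _ rfl)
  rw [hunion, Finset.prod_union hdisj,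
    Finset.prod_image fun a _ b _ h => Nat.eq_of_mul_eq_mul_right hp.pos h,
    Finset.prod_filter, ← Finset.prod_mul_distrib]
  refine Finset.prod_congr rfl fun d _ => ?_
  by_cases h : p ∣ d
  · simp [h, cyclotomic_expand_eq_cyclotomic hp h]
  · simp [h, cyclotomic_expand_eq_cyclotomic_mul hp h]

open scoped Pointwise in
/-- Expansion by `n` of the cyclotomic product over a divisor-closed finite set. -/
theorem prod_expand_cyclotomic (R : Type*) [CommRing R] {n : ℕ} (hn : n ≠ 0)
    (S : Finset ℕ) (hS : ∀ h ∈ S, ∀ d, d ∣ h → d ∈ S) :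
    ∏ d ∈ S, expand R n (cyclotomic d R) = ∏ e ∈ n.divisors * S, cyclotomic e R := by
  induction n using induction_on_primes generalizing S with
  | zero => exact absurd rfl hn
  | one => simp [Nat.divisors_one, Finset.singleton_one]
  | prime_mul p a hp ih =>
    have ha : a ≠ 0 := right_ne_zero_of_mul hn
    have hpS : ∀ h ∈ p.divisors * S, ∀ d, d ∣ h → d ∈ p.divisors * S := by
      intro h hh d hd
      obtain ⟨c, hc, e, he, rfl⟩ := Finset.mem_mul.1 hh
      obtain ⟨y, z, hy, hz, rfl⟩ := (Nat.dvd_mul).1 hd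
      exact Finset.mul_mem_mul
        (Nat.mem_divisors.2 ⟨hy.trans (Nat.dvd_of_mem_divisors hc), hp.ne_zero⟩) (hS e he z hz)
    rw [mul_comm p a, Nat.divisors_mul, mul_assoc, ← ih ha _ hpS, ← map_prod (expand R a),
      ← prod_expand_prime_cyclotomic R hp S hS, map_prod]
    exact Finset.prod_congr rfl fun d _ => expand_mul _ _ _

/-- **Decompression formula.** For a nonempty finite saturated set `Λ` of positive
integers and `n ≥ 1`, `Φ_Λ(xⁿ) = ∏_{e ∈ ⟨n⟩Λ} Φ_e(x)`, where `⟨n⟩Λ` is the set of products of a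
divisor of `n` and an element of `Λ`, each cyclotomic factor appearing exactly once. -/
theorem stmt_7 (n : ℕ) (hn : 0 < n) (Λ : Set ℕ) (hpos : ∀ m ∈ Λ, 0 < m)
    (hne : Λ.Nonempty) (hfin : Λ.Finite)
    (hsat : ∀ h ∈ Λ, ∀ d : ℕ, d ∣ h → d ∈ Λ) :
    (∏ᶠ d ∈ Λ, (cyclotomic d ℂ).comp (X ^ n)) =
      ∏ᶠ e ∈ {x : ℕ | ∃ d : ℕ, d ∣ n ∧ ∃ e' ∈ Λ, x = d * e'}, cyclotomic e ℂ := by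
  lift Λ to Finset ℕ using hfin
  simp only [Finset.mem_coe] at hsat ⊢
  have hset : {x : ℕ | ∃ d : ℕ, d ∣ n ∧ ∃ e' ∈ Λ, x = d * e'} =
      (Finset.image₂ (· * ·) n.divisors Λ : Finset ℕ) := by
    ext x
    simp only [Set.mem_ofPred_eq, Finset.mem_coe, Finset.mem_image₂, Nat.mem_divisors]
    simp [hn.ne', eq_comm]
  rw [hset, finprod_mem_coe_finset]
  simp only [← expand_eq_comp_X_pow]
  exact (finprod_mem_coe_finset _ Λ).trans (prod_expand_cyclotomic ℂ hn.ne' Λ hsat)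
end

section
/- Let n_1,…,n_k be positive integers with n_i not dividing n_j for i ≠ j, and let Λ = ⟨n_1,…,n_k⟩. Then the polynomial Φ_Λ(x) = ∏_{d∈Λ} Φ_d(x) is compressible, i.e., there exist an integer m ≥ 2 and a divisibility polynomial g with Φ_Λ(x) = g(x^m), if and only if gcd(n_1,…,n_k) > 1. Moreover, if N := gcd(n_1,…,n_k) > 1, one may take m = N and g = Φ_{⟨n_1/N,…,n_k/N⟩}. -/
open Polynomial

/-- The product of the cyclotomic polynomials `Φ_d` over all `d` dividing some `n i`. -/
noncomputable def cyclotomicDivisorProd {ι : Type*} (n : ι → ℕ) : ℂ[X] :=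
  ∏ᶠ d ∈ {d : ℕ | 0 < d ∧ ∃ i, d ∣ n i}, cyclotomic d ℂ

section

variable {ι : Type*} [Fintype ι] {n : ι → ℕ}

theorem cyclotomicDivisorProd_eq_prod (hn : ∀ i, 0 < n i) :
    cyclotomicDivisorProd n = ∏ d ∈ Finset.univ.biUnion fun i => (n i).divisors,
      cyclotomic d ℂ := by
  refine finprod_mem_eq_finite_toFinset_prod _ ?_ |>.trans ?_
  · refine ((Finset.univ.biUnion fun i => (n i).divisors).finite_toSet).subset ?_
    rintro d ⟨-, i, hi⟩
    simpa using ⟨i, hi, (hn i).ne'⟩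
  · congr 1
    ext d
    simp only [Set.Finite.mem_toFinset, Set.mem_ofPred_eq, Finset.mem_biUnion, Finset.mem_univ,
      true_and, Nat.mem_divisors]
    exact ⟨fun ⟨_, i, hi⟩ => ⟨i, hi, (hn i).ne'⟩,
      fun ⟨i, hi, _⟩ => ⟨Nat.pos_of_dvd_of_pos hi (hn i), i, hi⟩⟩

theorem cyclotomicDivisorProd_monic (hn : ∀ i, 0 < n i) : (cyclotomicDivisorProd n).Monic := by
  rw [cyclotomicDivisorProd_eq_prod hn]
  exact monic_prod_of_monic _ _ fun d _ => cyclotomic.monic d ℂ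

theorem cyclotomicDivisorProd_dvd_X_pow_sub_one (hn : ∀ i, 0 < n i) :
    cyclotomicDivisorProd n ∣ X ^ (∏ i, n i) - 1 := by
  have hpos : 0 < ∏ i, n i := Finset.prod_pos fun i _ => hn i
  rw [cyclotomicDivisorProd_eq_prod hn, ← prod_cyclotomic_eq_X_pow_sub_one hpos]
  refine Finset.prod_dvd_prod_of_subset _ _ _ (Finset.biUnion_subset.2 fun i hi => ?_)
  exact Nat.divisors_subset_of_dvd hpos.ne' (Finset.dvd_prod_of_mem n hi)

theorem isRoot_cyclotomicDivisorProd_iff (hn : ∀ i, 0 < n i) {z : ℂ} :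
    (cyclotomicDivisorProd n).IsRoot z ↔ ∃ i, z ^ n i = 1 := by
  rw [cyclotomicDivisorProd_eq_prod hn, isRoot_prod]
  constructor
  · rintro ⟨d, hd, hz⟩
    obtain ⟨i, -, hi⟩ := Finset.mem_biUnion.1 hd
    exact ⟨i, (isRoot_of_unity_iff (hn i) ℂ).2 ⟨d, hi, hz⟩⟩
  · rintro ⟨i, hi⟩
    obtain ⟨d, hd, hz⟩ := (isRoot_of_unity_iff (hn i) ℂ).1 hi
    exact ⟨d, Finset.mem_biUnion.2 ⟨i, Finset.mem_univ i, hd⟩, hz⟩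

/-- A divisor of some `X ^ M - 1` divides every nonzero polynomial vanishing at its roots. -/
theorem dvd_of_dvd_X_pow_sub_one_of_isRoot {f g : ℂ[X]} {M : ℕ} (hM : 0 < M)
    (hf : f ∣ X ^ M - 1) (hg : g ≠ 0) (h : ∀ z, f.IsRoot z → g.IsRoot z) : f ∣ g := by
  have hM' : (M : ℂ) ≠ 0 := Nat.cast_ne_zero.2 hM.ne'
  have hsep : f.Separable := (separable_X_pow_sub_C (1 : ℂ) hM' one_ne_zero).of_dvd (by simpa)
  have hf0 : f ≠ 0 := hsep.ne_zero
  refine (IsAlgClosed.splits f).dvd_of_roots_le_roots hf0 ?_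
  refine (Multiset.le_iff_subset (nodup_roots hsep)).2 fun z hz => ?_
  exact (mem_roots hg).2 (h z ((mem_roots hf0).1 hz))

theorem isDivPoly_cyclotomicDivisorProd (hn : ∀ i, 0 < n i) :
    IsDivPoly (cyclotomicDivisorProd n) := by
  intro m hm
  refine dvd_of_dvd_X_pow_sub_one_of_isRoot (Finset.prod_pos fun i _ => hn i)
    (cyclotomicDivisorProd_dvd_X_pow_sub_one hn) ?_ fun z hz => ?_
  · exact ((cyclotomicDivisorProd_monic hn).comp (monic_X_pow m) (by simpa using hm.ne')).ne_zero
  · obtain ⟨i, hi⟩ := (isRoot_cyclotomicDivisorProd_iff hn).1 hz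
    have h : (cyclotomicDivisorProd n).IsRoot (z ^ m) :=
      (isRoot_cyclotomicDivisorProd_iff hn).2 ⟨i, by rw [pow_right_comm, hi, one_pow]⟩
    simpa [IsRoot, eval_comp] using h

theorem cyclotomicDivisorProd_mul_right {N : ℕ} (hN : 0 < N) (hn : ∀ i, 0 < n i) :
    cyclotomicDivisorProd (fun i => N * n i) = (cyclotomicDivisorProd n).comp (X ^ N) := by
  have hNn : ∀ i, 0 < N * n i := fun i => Nat.mul_pos hN (hn i)
  have hmonic : ((cyclotomicDivisorProd n).comp (X ^ N)).Monic :=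
    (cyclotomicDivisorProd_monic hn).comp (monic_X_pow N) (by simpa using hN.ne')
  have hdvd : (cyclotomicDivisorProd n).comp (X ^ N) ∣ X ^ (N * ∏ i, n i) - 1 := by
    obtain ⟨q, hq⟩ := cyclotomicDivisorProd_dvd_X_pow_sub_one hn
    refine ⟨q.comp (X ^ N), ?_⟩
    rw [← mul_comp, ← hq]
    simp [pow_mul]
  have hroot : ∀ z, ((cyclotomicDivisorProd n).comp (X ^ N)).IsRoot z ↔
      (cyclotomicDivisorProd fun i => N * n i).IsRoot z := by
    intro z
    rw [isRoot_cyclotomicDivisorProd_iff hNn]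
    simp only [pow_mul]
    rw [← isRoot_cyclotomicDivisorProd_iff hn]
    simp [IsRoot, eval_comp]
  refine eq_of_monic_of_associated (cyclotomicDivisorProd_monic hNn) hmonic
    (associated_of_dvd_dvd ?_ ?_)
  · exact dvd_of_dvd_X_pow_sub_one_of_isRoot (Finset.prod_pos fun i _ => hNn i)
      (cyclotomicDivisorProd_dvd_X_pow_sub_one hNn) hmonic.ne_zero fun z => (hroot z).2
  · exact dvd_of_dvd_X_pow_sub_one_of_isRoot
      (Nat.mul_pos hN (Finset.prod_pos fun i _ => hn i)) hdvd
      (cyclotomicDivisorProd_monic hNn).ne_zero fun z => (hroot z).1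

theorem prime_dvd_of_cyclotomicDivisorProd_eq_comp (hn : ∀ i, 0 < n i)
    (hnd : ∀ i j, i ≠ j → ¬ n i ∣ n j) {m p : ℕ} (hp : p.Prime) (hpm : p ∣ m) {g : ℂ[X]}
    (hg : cyclotomicDivisorProd n = g.comp (X ^ m)) (i : ι) : p ∣ n i := by
  by_contra hpi
  have hζ := Complex.isPrimitiveRoot_exp (n i) (hn i).ne'
  have hω := Complex.isPrimitiveRoot_exp p hp.ne_zero
  set ζ := Complex.exp (2 * Real.pi * Complex.I / (n i : ℕ))
  set ω := Complex.exp (2 * Real.pi * Complex.I / (p : ℕ))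
  have hroot : (cyclotomicDivisorProd n).IsRoot (ζ * ω) := by
    have h : (cyclotomicDivisorProd n).IsRoot ζ :=
      (isRoot_cyclotomicDivisorProd_iff hn).2 ⟨i, hζ.pow_eq_one⟩
    rw [hg] at h ⊢
    simpa [IsRoot, eval_comp, mul_pow, (hω.pow_eq_one_iff_dvd m).2 hpm] using h
  obtain ⟨j, hj⟩ := (isRoot_cyclotomicDivisorProd_iff hn).1 hroot
  have horder : orderOf (ζ * ω) = n i * p := by
    rw [(Commute.all ζ ω).orderOf_mul_eq_mul_orderOf_of_coprime, ← hζ.eq_orderOf,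
      ← hω.eq_orderOf]
    rw [← hζ.eq_orderOf, ← hω.eq_orderOf]
    exact ((Nat.Prime.coprime_iff_not_dvd hp).2 hpi).symm
  have hdvd : n i * p ∣ n j := horder ▸ orderOf_dvd_of_pow_eq_one hj
  by_cases hij : i = j
  · subst hij
    exact hpi ((dvd_mul_left p (n i)).trans hdvd)
  · exact hnd i j hij ((dvd_mul_right (n i) p).trans hdvd)

end

/-- For positive integers `n₁, …, n_k` with `nᵢ ∤ n_j` for `i ≠ j`, the
polynomial `Φ_{⟨n₁,…,n_k⟩}` is compressible (equal to `g(x^m)` for some divisibility polynomial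
`g` and `m ≥ 2`) iff `gcd(n₁,…,n_k) > 1`; and in that case, with `N` the gcd, one may take
`m = N` and `g = Φ_{⟨n₁/N,…,n_k/N⟩}`. -/
theorem stmt_8 (k : ℕ) (hk : 0 < k) (n : Fin k → ℕ) (hpos : ∀ i, 0 < n i)
    (hnd : ∀ i j, i ≠ j → ¬ n i ∣ n j) :
    ((∃ m : ℕ, 2 ≤ m ∧ ∃ g : Polynomial ℂ, IsDivPoly g ∧
        (∏ᶠ d ∈ {d : ℕ | 0 < d ∧ ∃ i, d ∣ n i}, cyclotomic d ℂ) = g.comp (X ^ m)) ↔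
      1 < Finset.univ.gcd n) ∧
    (1 < Finset.univ.gcd n →
      IsDivPoly (∏ᶠ d ∈ {d : ℕ | 0 < d ∧ ∃ i, d ∣ n i / Finset.univ.gcd n}, cyclotomic d ℂ) ∧
      (∏ᶠ d ∈ {d : ℕ | 0 < d ∧ ∃ i, d ∣ n i}, cyclotomic d ℂ) =
        (∏ᶠ d ∈ {d : ℕ | 0 < d ∧ ∃ i, d ∣ n i / Finset.univ.gcd n},
            cyclotomic d ℂ).comp (X ^ Finset.univ.gcd n)) := by
  have hgcd0 : 0 < Finset.univ.gcd n := Nat.pos_of_ne_zero fun h =>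
    (hpos ⟨0, hk⟩).ne' (Finset.gcd_eq_zero_iff.1 h _ (Finset.mem_univ _))
  have hdvd : ∀ i, Finset.univ.gcd n ∣ n i := fun i => Finset.gcd_dvd (Finset.mem_univ i)
  have hquot : ∀ i, 0 < n i / Finset.univ.gcd n := fun i =>
    Nat.div_pos (Nat.le_of_dvd (hpos i) (hdvd i)) hgcd0
  have hdiv := isDivPoly_cyclotomicDivisorProd hquot
  have hcomp := cyclotomicDivisorProd_mul_right hgcd0 hquot
  simp only [Nat.mul_div_cancel' (hdvd _)] at hcomp
  refine ⟨⟨?_, fun h => ⟨_, h, _, hdiv, hcomp⟩⟩, fun _ => ⟨hdiv, hcomp⟩⟩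
  rintro ⟨m, hm, g, -, hg⟩
  obtain ⟨p, hp, hpm⟩ := Nat.exists_prime_and_dvd (show m ≠ 1 by omega)
  have hpgcd : p ∣ Finset.univ.gcd n := Finset.dvd_gcd fun i _ =>
    prime_dvd_of_cyclotomicDivisorProd_eq_comp hpos hnd hp hpm hg i
  exact hp.one_lt.trans_le (Nat.le_of_dvd hgcd0 hpgcd)
end

section
/- Every nonzero divisibility polynomial f with complex coefficients can be written as f(x) = C·x^s·g(x), where C is a nonzero complex constant, s is a nonnegative integer, and g(x) is a finite product of factors of the form Φ_{⟨n_1,…,n_k⟩}(x^m), where in each factor m ≥ 1 is an integer and n_1,…,n_k are positive integers satisfying n_i ∤ n_j for i ≠ j and gcd(n_1,…,n_k) = 1. -/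
open Polynomial

theorem rootMultiplicity_comp_X_pow {p : ℂ[X]} (hp : p ≠ 0) {n : ℕ} (hn : 0 < n) {a : ℂ}
    (ha : a ≠ 0) :
    rootMultiplicity a (p.comp (X ^ n)) = rootMultiplicity (a ^ n) p := by
  obtain ⟨q, hq, hdvd⟩ := exists_eq_pow_rootMultiplicity_mul_and_not_dvd p hp (a ^ n)
  obtain ⟨r, hr⟩ : X - C a ∣ (X ^ n - C (a ^ n) : ℂ[X]) := by
    rw [dvd_iff_isRoot]; simp
  have hra : r.eval a ≠ 0 := by
    intro h
    have h1 := congrArg (fun f => (derivative f).eval a) hr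
    rw [derivative_sub, derivative_X_pow, derivative_C, derivative_mul] at h1
    simp [h, ha, hn.ne'] at h1
  have hqa : (q.comp (X ^ n)).eval a ≠ 0 := by
    intro h
    exact hdvd (dvd_iff_isRoot.2 (by simpa [eval_comp] using h))
  have hcomp : p.comp (X ^ n) =
      (X - C a) ^ rootMultiplicity (a ^ n) p * (r ^ rootMultiplicity (a ^ n) p * q.comp (X ^ n)) := by
    conv_lhs => rw [hq]
    rw [mul_comp, pow_comp, sub_comp, X_comp, C_comp, hr, mul_pow, mul_assoc]
  have hs : (r ^ rootMultiplicity (a ^ n) p * q.comp (X ^ n)).eval a ≠ 0 := by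
    rw [eval_mul, eval_pow]
    exact mul_ne_zero (pow_ne_zero _ hra) hqa
  have hs0 : r ^ rootMultiplicity (a ^ n) p * q.comp (X ^ n) ≠ 0 := by
    intro h
    simp [h] at hs
  have hXa : (X - C a : ℂ[X]) ^ rootMultiplicity (a ^ n) p ≠ 0 := pow_ne_zero _ (X_sub_C_ne_zero a)
  rw [hcomp, rootMultiplicity_mul (mul_ne_zero hXa hs0), rootMultiplicity_X_sub_C_pow,
    rootMultiplicity_eq_zero hs, add_zero]

theorem isOfFinOrder_of_pow_mem_finset {S : Finset ℂ} {a : ℂ} (ha : a ≠ 0)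
    (hS : ∀ n : ℕ, 0 < n → a ^ n ∈ S) : IsOfFinOrder a := by
  obtain ⟨i, j, hij, h⟩ := Finite.exists_ne_map_eq_of_infinite
    (fun n : ℕ => (⟨a ^ (n + 1), hS (n + 1) n.succ_pos⟩ : S))
  rw [Subtype.mk.injEq] at h
  wlog hlt : i < j generalizing i j
  · exact this j i hij.symm h.symm (by omega)
  refine isOfFinOrder_iff_pow_eq_one.2 ⟨j - i, by omega, ?_⟩
  have h1 : a ^ (i + 1) * a ^ (j - i) = a ^ (i + 1) * 1 := by
    rw [← pow_add, mul_one, h]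
    congr 1
    omega
  exact mul_left_cancel₀ (pow_ne_zero _ ha) h1

theorem prod_cyclotomic_eq_prod_X_sub_C (D : Finset ℕ) (hD : ∀ d ∈ D, 0 < d) :
    ∏ d ∈ D, cyclotomic d ℂ = ∏ b ∈ D.biUnion (fun d => primitiveRoots d ℂ), (X - C b) := by
  rw [Finset.prod_biUnion fun _ _ _ _ h => IsPrimitiveRoot.disjoint h]
  refine Finset.prod_congr rfl fun d hd => ?_
  exact cyclotomic_eq_prod_X_sub_primitiveRoots (Complex.isPrimitiveRoot_exp d (hD d hd).ne')

theorem exists_antichain_of_pow_closed (S : Finset ℂ) (hne : S.Nonempty) (h0 : (0 : ℂ) ∉ S)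
    (hS : ∀ a ∈ S, ∀ n : ℕ, 0 < n → a ^ n ∈ S) :
    ∃ T : Finset ℕ, T.Nonempty ∧ (∀ t ∈ T, 0 < t) ∧
      (∀ t ∈ T, ∀ u ∈ T, t ∣ u → t = u) ∧ ∀ a : ℂ, a ∈ S ↔ ∃ t ∈ T, a ^ t = 1 := by
  have hfin : ∀ a ∈ S, IsOfFinOrder a := fun a ha =>
    isOfFinOrder_of_pow_mem_finset (fun h => h0 (h ▸ ha)) (hS a ha)
  obtain ⟨T, hT⟩ : ∃ T : Finset ℕ, ∀ t, t ∈ T ↔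
      t ∈ S.image orderOf ∧ ∀ u ∈ S.image orderOf, t ∣ u → t = u := by
    classical
    exact ⟨(S.image orderOf).filter fun t => ∀ u ∈ S.image orderOf, t ∣ u → t = u,
      fun _ => by simp only [Finset.mem_filter]⟩
  have hmax : ∀ a ∈ S, ∃ t ∈ T, orderOf a ∣ t := by
    intro a ha
    obtain ⟨t, -, ht⟩ := Finset.exists_le_maximal ((S.image orderOf).filter (orderOf a ∣ ·))
      (Finset.mem_filter.2 ⟨Finset.mem_image_of_mem _ ha, dvd_rfl⟩)
    obtain ⟨htS, hat⟩ := Finset.mem_filter.1 ht.prop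
    refine ⟨t, (hT t).2 ⟨htS, fun u hu htu => ?_⟩, hat⟩
    have hu0 : 0 < u := by
      obtain ⟨b, hb, rfl⟩ := Finset.mem_image.1 hu
      exact orderOf_pos_iff.2 (hfin b hb)
    exact le_antisymm (Nat.le_of_dvd hu0 htu)
      (ht.le_of_ge (Finset.mem_filter.2 ⟨hu, hat.trans htu⟩) (Nat.le_of_dvd hu0 htu))
  refine ⟨T, ?_, ?_, ?_, ?_⟩
  · obtain ⟨a, ha⟩ := hne
    obtain ⟨t, ht, -⟩ := hmax a ha
    exact ⟨t, ht⟩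
  · intro t ht
    obtain ⟨b, hb, rfl⟩ := Finset.mem_image.1 ((hT t).1 ht).1
    exact orderOf_pos_iff.2 (hfin b hb)
  · intro t ht u hu
    exact ((hT t).1 ht).2 u ((hT u).1 hu).1
  · intro a
    constructor
    · intro ha
      obtain ⟨t, ht, hat⟩ := hmax a ha
      exact ⟨t, ht, orderOf_dvd_iff_pow_eq_one.1 hat⟩
    · rintro ⟨t, ht, hat⟩
      obtain ⟨b, hb, rfl⟩ := Finset.mem_image.1 ((hT t).1 ht).1
      have hpos := orderOf_pos_iff.2 (hfin b hb)
      have : NeZero (orderOf b) := ⟨hpos.ne'⟩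
      obtain ⟨i, -, rfl⟩ := (IsPrimitiveRoot.orderOf b).eq_pow_of_pow_eq_one hat
      rw [← mul_one (b ^ i), ← pow_orderOf_eq_one b, ← pow_add]
      exact hS b hb _ (by omega)

theorem prod_X_sub_C_eq_cyclotomic_comp (S : Finset ℂ) (hne : S.Nonempty) (h0 : (0 : ℂ) ∉ S)
    (hS : ∀ a ∈ S, ∀ n : ℕ, 0 < n → a ^ n ∈ S) :
    ∃ (m k : ℕ) (nn : Fin k → ℕ), 1 ≤ m ∧ (∀ i, 0 < nn i) ∧
      (∀ i j, i ≠ j → ¬ nn i ∣ nn j) ∧ Finset.univ.gcd nn = 1 ∧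
      ∏ a ∈ S, (X - C a) =
        (∏ᶠ d ∈ {d : ℕ | 0 < d ∧ ∃ i, d ∣ nn i}, cyclotomic d ℂ).comp (X ^ m) := by
  obtain ⟨T, ⟨t₀, ht₀⟩, hpos, hanti, hT⟩ := exists_antichain_of_pow_closed S hne h0 hS
  let e := T.equivFin.symm
  let t : Fin T.card → ℕ := fun i => (e i : ℕ)
  have htpos : ∀ i, 0 < t i := fun i => hpos _ (e i).2
  have htT : ∀ u ∈ T, ∃ i, t i = u := fun u hu => ⟨e.symm ⟨u, hu⟩, by simp [t]⟩
  obtain ⟨i₀, -⟩ := htT t₀ ht₀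
  let m := Finset.univ.gcd t
  have hmt : ∀ i, m ∣ t i := fun i => Finset.gcd_dvd (Finset.mem_univ i)
  have hm : 0 < m := Nat.pos_of_dvd_of_pos (hmt i₀) (htpos i₀)
  have hq : ∀ i, 0 < t i / m := fun i => Nat.div_pos (Nat.le_of_dvd (htpos i) (hmt i)) hm
  refine ⟨m, T.card, fun i => t i / m, hm, hq, ?_,
    Finset.gcd_div_eq_one (Finset.mem_univ i₀) (htpos i₀).ne', ?_⟩
  · intro i j hij hdvd
    have h1 : t i ∣ t j := by
      rw [← Nat.div_mul_cancel (hmt i), ← Nat.div_mul_cancel (hmt j)]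
      exact Nat.mul_dvd_mul_right hdvd m
    exact hij (e.injective (Subtype.ext (hanti _ (e i).2 _ (e j).2 h1)))
  have hset : {d : ℕ | 0 < d ∧ ∃ i, d ∣ t i / m} =
      ↑(Finset.univ.biUnion fun i => (t i / m).divisors) := by
    ext d
    simp only [Set.mem_ofPred_eq, Finset.coe_biUnion, Finset.coe_univ, Set.mem_univ,
      Set.iUnion_true, Set.mem_iUnion, Finset.mem_coe, Nat.mem_divisors]
    exact ⟨fun ⟨_, i, hi⟩ => ⟨i, hi, (hq i).ne'⟩,
      fun ⟨i, hi, _⟩ => ⟨Nat.pos_of_dvd_of_pos hi (hq i), i, hi⟩⟩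
  rw [hset, finprod_mem_coe_finset]
  set D := Finset.univ.biUnion fun i => (t i / m).divisors with hDdef
  have hDpos : ∀ d ∈ D, 0 < d := by
    intro d hd
    obtain ⟨i, -, hi⟩ := Finset.mem_biUnion.1 hd
    exact Nat.pos_of_mem_divisors hi
  rw [prod_cyclotomic_eq_prod_X_sub_C D hDpos]
  set R := D.biUnion fun d => primitiveRoots d ℂ with hRdef
  have hR : ∀ b : ℂ, b ∈ R ↔ ∃ i, b ^ (t i / m) = 1 := by
    intro b
    rw [hRdef, Finset.mem_biUnion]
    constructor
    · rintro ⟨d, hd, hb⟩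
      obtain ⟨i, -, hi⟩ := Finset.mem_biUnion.1 hd
      rw [mem_primitiveRoots (hDpos d hd)] at hb
      exact ⟨i, hb.pow_eq_one_iff_dvd _ |>.2 (Nat.dvd_of_mem_divisors hi)⟩
    · rintro ⟨i, hi⟩
      have hd : orderOf b ∈ D := Finset.mem_biUnion.2 ⟨i, Finset.mem_univ i,
        Nat.mem_divisors.2 ⟨orderOf_dvd_of_pow_eq_one hi, (hq i).ne'⟩⟩
      exact ⟨_, hd, (mem_primitiveRoots (hDpos _ hd)).2 (IsPrimitiveRoot.orderOf b)⟩
  have hSR : ∀ a : ℂ, a ∈ S ↔ a ^ m ∈ R := by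
    intro a
    rw [hT, hR]
    simp only [← pow_mul, fun i => Nat.mul_div_cancel' (hmt i)]
    constructor
    · rintro ⟨u, hu, h⟩
      obtain ⟨i, rfl⟩ := htT u hu
      exact ⟨i, h⟩
    · rintro ⟨i, h⟩
      exact ⟨t i, (e i).2, h⟩
  have hmon : ((∏ b ∈ R, (X - C b)).comp (X ^ m)).Monic :=
    (monic_prod_X_sub_C _ _).comp (monic_X_pow m) (by simpa using hm.ne')
  have hroots : ((∏ b ∈ R, (X - C b)).comp (X ^ m)).roots = S.val := by
    ext a
    rw [count_roots]
    by_cases ha : a = 0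
    · subst ha
      rw [Multiset.count_eq_zero.2 h0, rootMultiplicity_eq_zero]
      rw [hSR, zero_pow hm.ne'] at h0
      simpa [IsRoot, eval_comp, eval_prod, hm.ne', Finset.prod_eq_zero_iff] using h0
    · rw [rootMultiplicity_comp_X_pow (monic_prod_X_sub_C _ _).ne_zero hm ha, ← count_roots,
        roots_prod_X_sub_C]
      by_cases haS : a ∈ S
      · rw [Multiset.count_eq_one_of_mem S.nodup haS,
          Multiset.count_eq_one_of_mem R.nodup ((hSR a).1 haS)]
      · rw [Multiset.count_eq_zero.2 haS, Multiset.count_eq_zero.2 fun h => haS ((hSR a).2 h)]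
  have hprod := (IsAlgClosed.splits _).eq_prod_roots_of_monic hmon
  rw [hroots] at hprod
  exact hprod.symm

theorem eq_C_mul_X_pow_of_roots_eq_zero {f : ℂ[X]} (h : ∀ a ∈ f.roots, a = 0) :
    f = C f.leadingCoeff * X ^ f.roots.card := by
  conv_lhs => rw [(IsAlgClosed.splits f).eq_prod_roots, Multiset.eq_replicate_card.2 h]
  simp

theorem exists_factorization_of_rootMultiplicity_le (N : ℕ) (f : ℂ[X]) (hN : f.natDegree ≤ N)
    (hf : f ≠ 0) (hmult : ∀ a : ℂ, a ≠ 0 → ∀ n : ℕ, 0 < n →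
      rootMultiplicity a f ≤ rootMultiplicity (a ^ n) f) :
    ∃ (C : ℂ) (s : ℕ) (L : List (Polynomial ℂ)), C ≠ 0 ∧
      (∀ p ∈ L, ∃ (m k : ℕ) (nn : Fin k → ℕ), 1 ≤ m ∧ (∀ i, 0 < nn i) ∧
        (∀ i j, i ≠ j → ¬ nn i ∣ nn j) ∧ Finset.univ.gcd nn = 1 ∧
        p = (∏ᶠ d ∈ {d : ℕ | 0 < d ∧ ∃ i, d ∣ nn i}, cyclotomic d ℂ).comp (X ^ m)) ∧
      f = C • (X ^ s * L.prod) := by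
  induction N generalizing f with
  | zero =>
    refine ⟨f.leadingCoeff, 0, [], leadingCoeff_ne_zero.2 hf, by simp, ?_⟩
    rw [eq_C_of_natDegree_le_zero hN]
    simp [smul_eq_C_mul]
  | succ N ih =>
    let S := f.roots.toFinset.erase 0
    have hmem : ∀ a, a ∈ S ↔ a ≠ 0 ∧ 0 < rootMultiplicity a f := by
      intro a
      simp [S, hf]
    by_cases hne : S.Nonempty
    · have hS : ∀ a ∈ S, ∀ n : ℕ, 0 < n → a ^ n ∈ S := by
        intro a ha n hn
        rw [hmem] at ha ⊢
        exact ⟨pow_ne_zero _ ha.1, ha.2.trans_le (hmult a ha.1 n hn)⟩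
      have h0 : (0 : ℂ) ∉ S := by simp [S]
      have hg0 : ∏ a ∈ S, (X - C a) ≠ 0 := (monic_prod_X_sub_C _ _).ne_zero
      obtain ⟨h, hfh⟩ : ∏ a ∈ S, (X - C a) ∣ f := by
        refine dvd_trans (Multiset.prod_dvd_prod_of_le (Multiset.map_le_map ?_))
          (prod_multiset_X_sub_C_dvd f)
        exact (Finset.val_le_iff.2 (Finset.erase_subset _ _)).trans (Multiset.dedup_le _)
      have hh0 : h ≠ 0 := fun hh => hf (by rw [hfh, hh, mul_zero])
      have hrm : ∀ a, rootMultiplicity a f = S.val.count a + rootMultiplicity a h := by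
        intro a
        conv_lhs => rw [hfh]
        rw [rootMultiplicity_mul (mul_ne_zero hg0 hh0), ← count_roots, roots_prod_X_sub_C]
      have hdeg : h.natDegree ≤ N := by
        have h1 : f.natDegree = S.card + h.natDegree := by
          conv_lhs => rw [hfh]
          rw [natDegree_mul hg0 hh0, natDegree_prod_of_monic _ _ fun a _ => monic_X_sub_C a]
          simp
        have := hne.card_pos
        omega
      obtain ⟨c, s, L, hc, hL, hprod⟩ := ih h hdeg hh0 (by
        intro a ha n hn
        by_cases haS : a ∈ S
        · have h1 := hmult a ha n hn
          rw [hrm, hrm (a ^ n), Multiset.count_eq_one_of_mem S.nodup haS,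
            Multiset.count_eq_one_of_mem S.nodup (hS a haS n hn)] at h1
          omega
        · have h1 : rootMultiplicity a f = 0 := by
            by_contra h2
            exact haS ((hmem a).2 ⟨ha, Nat.pos_of_ne_zero h2⟩)
          rw [hrm] at h1
          omega)
      refine ⟨c, s, (∏ a ∈ S, (X - C a)) :: L, hc, ?_, ?_⟩
      · intro p hp
        rcases List.mem_cons.1 hp with rfl | hp
        · exact prod_X_sub_C_eq_cyclotomic_comp S hne h0 hS
        · exact hL p hp
      · conv_lhs => rw [hfh, hprod]
        rw [List.prod_cons, mul_smul_comm, mul_left_comm]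
    · refine ⟨f.leadingCoeff, f.roots.card, [], leadingCoeff_ne_zero.2 hf, by simp, ?_⟩
      rw [List.prod_nil, mul_one, smul_eq_C_mul]
      refine eq_C_mul_X_pow_of_roots_eq_zero fun a ha => ?_
      by_contra ha0
      exact hne ⟨a, by simpa [S, ha0] using ha⟩

/-- Every nonzero divisibility polynomial is `C·x^s·g(x)` with `C ≠ 0`,
`s ≥ 0`, and `g` a finite product of factors `Φ_{⟨n₁,…,n_k⟩}(x^m)` with `m ≥ 1`, the `nᵢ`
positive, pairwise nondividing, and with gcd `1`. -/
theorem stmt_9 (f : Polynomial ℂ) (hf : f ≠ 0)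
    (hdiv : ∀ n : ℕ, 0 < n → f ∣ f.comp (X ^ n)) :
    ∃ (C : ℂ) (s : ℕ) (L : List (Polynomial ℂ)), C ≠ 0 ∧
      (∀ p ∈ L, ∃ (m k : ℕ) (nn : Fin k → ℕ), 1 ≤ m ∧ (∀ i, 0 < nn i) ∧
        (∀ i j, i ≠ j → ¬ nn i ∣ nn j) ∧ Finset.univ.gcd nn = 1 ∧
        p = (∏ᶠ d ∈ {d : ℕ | 0 < d ∧ ∃ i, d ∣ nn i}, cyclotomic d ℂ).comp (X ^ m)) ∧
      f = C • (X ^ s * L.prod) := by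
  refine exists_factorization_of_rootMultiplicity_le f.natDegree f le_rfl hf fun a ha n hn => ?_
  rw [← rootMultiplicity_comp_X_pow hf hn ha]
  refine rootMultiplicity_le_rootMultiplicity_of_dvd ?_ (hdiv n hn) a
  rw [← expand_eq_comp_X_pow]
  exact (expand_ne_zero hn).2 hf
end

section
/- Let N_1,…,N_k be pairwise coprime positive integers. Then (x−1)^{k−1} divides the polynomial (x^{N_1}−1)⋯(x^{N_k}−1) in ℂ[X], and the quotient f(x) = (x^{N_1}−1)⋯(x^{N_k}−1)/(x−1)^{k−1} is a divisibility polynomial: f(x) divides f(x^n) in ℂ[X] for every positive integer n. -/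
open Polynomial

/-- The polynomial `1 + x + ⋯ + x^{m-1}` has no root in common with `x - 1` when `m > 0`. -/
lemma isCoprime_X_sub_one_geom_sum {m : ℕ} (hm : 0 < m) :
    IsCoprime (X - 1 : ℂ[X]) (∑ l ∈ Finset.range m, X ^ l) := by
  rw [isCoprime_iff_aeval_ne_zero_of_isAlgClosed ℂ ℂ]
  intro z
  by_cases hz : z = 1
  · right
    simp [hz, hm.ne']
  · left
    simpa [sub_eq_zero] using hz

/-- For coprime `a` and `b`, the polynomials `1 + x + ⋯ + x^{a-1}` and `1 + x + ⋯ + x^{b-1}`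
are coprime. -/
lemma isCoprime_geom_sum_geom_sum {a b : ℕ} (ha : 0 < a) (hab : a.Coprime b) :
    IsCoprime (∑ l ∈ Finset.range a, X ^ l : ℂ[X]) (∑ l ∈ Finset.range b, X ^ l) := by
  rw [isCoprime_iff_aeval_ne_zero_of_isAlgClosed ℂ ℂ]
  intro z
  by_contra! h
  obtain ⟨h₁, h₂⟩ := h
  simp only [map_sum, map_pow, aeval_X] at h₁ h₂
  have hza : z ^ a = 1 := by
    have := geom_sum_mul z a
    rw [h₁, zero_mul] at this
    exact sub_eq_zero.mp this.symm
  have hzb : z ^ b = 1 := by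
    have := geom_sum_mul z b
    rw [h₂, zero_mul] at this
    exact sub_eq_zero.mp this.symm
  have hz : z = 1 := by
    have hdvd := Nat.dvd_gcd (orderOf_dvd_of_pow_eq_one hza) (orderOf_dvd_of_pow_eq_one hzb)
    rw [hab.gcd_eq_one, Nat.dvd_one] at hdvd
    exact orderOf_eq_one_iff.mp hdvd
  simp [hz, ha.ne'] at h₁

/-- For pairwise coprime positive integers `N₁, …, N_k`, `(x−1)^{k−1}` divides
`(x^{N₁}−1)⋯(x^{N_k}−1)` in `ℂ[X]`, and the quotient `f` is a divisibility polynomial: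
`f(x) ∣ f(xⁿ)` for every `n ≥ 1`. -/
theorem stmt_11 (k : ℕ) (N : Fin k → ℕ) (hpos : ∀ i, 0 < N i)
    (hcop : ∀ i j, i ≠ j → Nat.Coprime (N i) (N j)) :
    ∃ f : Polynomial ℂ,
      (∏ i : Fin k, (X ^ (N i) - 1)) = (X - 1) ^ (k - 1) * f ∧
      ∀ n : ℕ, 0 < n → f ∣ f.comp (X ^ n) := by
  rcases k with _ | k
  · exact ⟨1, by simp, by simp⟩
  refine ⟨(X - 1) * ∏ i, ∑ l ∈ Finset.range (N i), X ^ l, ?_, fun n _ => ?_⟩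
  · simp_rw [← geom_sum_mul (X : ℂ[X])]
    rw [Finset.prod_mul_distrib, Finset.prod_const, Finset.card_univ, Fintype.card_fin,
      Nat.add_sub_cancel]
    ring
  · rw [mul_comp, prod_comp]
    refine IsCoprime.mul_dvd
      (IsCoprime.prod_right fun i _ => isCoprime_X_sub_one_geom_sum (hpos i)) ?_ ?_
    · refine Dvd.dvd.mul_right ?_ _
      simpa using sub_dvd_pow_sub_pow (X : ℂ[X]) 1 n
    · refine Finset.prod_dvd_of_coprime
        (fun i _ j _ hij => isCoprime_geom_sum_geom_sum (hpos i) (hcop i j hij)) fun i hi => ?_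
      refine dvd_trans ?_ (mul_dvd_mul_left _ (Finset.dvd_prod_of_mem _ hi))
      have hfactor : (X - 1 : ℂ[X]).comp (X ^ n) *
          (∑ l ∈ Finset.range (N i), X ^ l : ℂ[X]).comp (X ^ n) = (X ^ N i) ^ n - 1 := by
        rw [← mul_comp, mul_geom_sum]
        simp [← pow_mul, mul_comm n]
      rw [hfactor]
      refine (Dvd.intro _ (geom_sum_mul (X : ℂ[X]) (N i))).trans ?_
      simpa using sub_dvd_pow_sub_pow (X ^ N i : ℂ[X]) 1 n
end

section
/- Let Λ be a nonempty finite saturated subset of the positive integers and n a positive integer. Then there exists a polynomial P in two variables with integer coefficients such that for all complex numbers x and y: Φ_Λ(x^n, y^n) = Φ_Λ(x, y) · P(x + y, x·y), where Φ_Λ(x,y) := ∏_{d∈Λ} ∏_{ζ} (x − ζ y), the inner product running over all primitive d-th roots of unity ζ. -/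
open Polynomial

/-- A homogenized integer polynomial may be evaluated through a factorization over `ℂ`. -/
lemma aeval_homogenize_of_map_eq_prod {p : ℤ[X]} {S : Finset ℂ} {f : ℂ → ℂ[X]} {k : ℕ}
    (hp : p.map (Int.castRingHom ℂ) = ∏ ζ ∈ S, f ζ) (hf : ∀ ζ ∈ S, (f ζ).natDegree ≤ k)
    (g : Fin 2 → ℂ) :
    MvPolynomial.aeval g (p.homogenize (S.card * k)) =
      ∏ ζ ∈ S, MvPolynomial.eval g ((f ζ).homogenize k) := by
  rw [MvPolynomial.aeval_def, ← MvPolynomial.eval_map, algebraMap_int_eq, ← homogenize_map, hp,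
    ← map_prod, ← homogenize_finsetProd (n := fun _ => k) hf]
  simp

lemma prod_sub_mul_swap {S : Finset ℂ} (h0 : (0 : ℂ) ∉ S) (hinv : ∀ ζ ∈ S, ζ⁻¹ ∈ S) (x y : ℂ) :
    ∏ ζ ∈ S, (y - ζ * x) = (∏ ζ ∈ S, -ζ) * ∏ ζ ∈ S, (x - ζ * y) := by
  have h : ∏ ζ ∈ S, (x - ζ * y) = ∏ ζ ∈ S, (x - ζ⁻¹ * y) :=
    Finset.prod_nbij' (·⁻¹) (·⁻¹) hinv hinv (by simp) (by simp) (by simp)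
  rw [h, ← Finset.prod_mul_distrib]
  refine Finset.prod_congr rfl fun ζ hζ => ?_
  have : ζ ≠ 0 := fun h => h0 (h ▸ hζ)
  field_simp
  ring

lemma prod_X_sub_C_dvd_prod_X_pow_sub_C {S : Finset ℂ} {n : ℕ} (hpow : ∀ ζ ∈ S, ζ ^ n ∈ S) :
    ∏ ζ ∈ S, (X - C ζ) ∣ ∏ ζ ∈ S, (X ^ n - C ζ) := by
  refine Finset.prod_dvd_of_coprime
    (fun a _ b _ h => pairwise_coprime_X_sub_C Function.injective_id h) fun a ha => ?_
  refine dvd_trans ?_ (Finset.dvd_prod_of_mem _ (hpow a ha))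
  simp [dvd_iff_isRoot]

/-- Symmetric integer polynomials in two variables are polynomials in the sum and the product. -/
lemma exists_aeval_add_mul_of_isSymmetric {Q : MvPolynomial (Fin 2) ℤ} (hQ : Q.IsSymmetric) :
    ∃ P : MvPolynomial (Fin 2) ℤ, ∀ x y : ℂ,
      MvPolynomial.aeval ![x, y] Q = MvPolynomial.aeval ![x + y, x * y] P := by
  obtain ⟨P, hP⟩ := (MvPolynomial.esymmAlgHom_fin_bijective ℤ 2).2 ⟨Q, hQ⟩
  refine ⟨P, fun x y => ?_⟩
  have h := MvPolynomial.esymmAlgHom_apply (σ := Fin 2) P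
  rw [hP] at h
  change Q = _ at h
  rw [h, MvPolynomial.comp_aeval_apply]
  congr 2
  ext i
  fin_cases i
  · simp [MvPolynomial.esymm_one]
  · rw [MvPolynomial.aeval_esymm_eq_multiset_esymm]
    rw [Fin.univ_val_map]
    exact Multiset.esymm_pair_two x y

lemma MvPolynomial.eq_of_aeval_complex_eq {A B : MvPolynomial (Fin 2) ℤ}
    (h : ∀ x y : ℂ, aeval ![x, y] A = aeval ![x, y] B) : A = B := by
  apply map_injective (Int.castRingHom ℂ) (RingHom.injective_int _)
  refine funext fun g => ?_
  have hg : g = ![g 0, g 1] := by ext i; fin_cases i <;> rfl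
  rw [hg, eval_map, eval_map, ← algebraMap_int_eq, ← aeval_def, ← aeval_def, h]

lemma MvPolynomial.isSymmetric_of_rename_swap {Q : MvPolynomial (Fin 2) ℤ}
    (h : rename (Equiv.swap 0 1) Q = Q) : Q.IsSymmetric := by
  intro e
  have he : e = 1 ∨ e = Equiv.swap 0 1 := by revert e; decide
  rcases he with rfl | rfl
  · simp
  · exact h

/-- If `F = ∏ (X₀ - ζ X₁)` over a set of nonzero numbers closed under inversion, then the quotient
of `F(X₀ⁿ, X₁ⁿ)` by `F` is symmetric. -/
lemma isSymmetric_of_prod_pow_sub_eq {S : Finset ℂ} (h0 : (0 : ℂ) ∉ S)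
    (hinv : ∀ ζ ∈ S, ζ⁻¹ ∈ S) {n : ℕ} {F Q : MvPolynomial (Fin 2) ℤ} (hF0 : F ≠ 0)
    (hF : ∀ x y : ℂ, MvPolynomial.aeval ![x, y] F = ∏ ζ ∈ S, (x - ζ * y))
    (hQ : ∀ x y : ℂ, ∏ ζ ∈ S, (x ^ n - ζ * y ^ n) = MvPolynomial.aeval ![x, y] (F * Q)) :
    Q.IsSymmetric := by
  apply MvPolynomial.isSymmetric_of_rename_swap
  apply mul_left_cancel₀ hF0
  refine MvPolynomial.eq_of_aeval_complex_eq fun x y => ?_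
  have hc : ∏ ζ ∈ S, -ζ ≠ 0 :=
    Finset.prod_ne_zero_iff.2 fun ζ hζ => neg_ne_zero.2 fun h => h0 (h ▸ hζ)
  have hswap : ![x, y] ∘ Equiv.swap 0 1 = ![y, x] := by ext i; fin_cases i <;> simp
  apply mul_left_cancel₀ hc
  rw [← hQ, ← prod_sub_mul_swap h0 hinv, hQ, map_mul, map_mul, MvPolynomial.aeval_rename, hswap,
    hF, hF, ← mul_assoc, ← prod_sub_mul_swap h0 hinv]

theorem exists_prod_pow_sub_eq {S : Finset ℂ} (h0 : (0 : ℂ) ∉ S) (hinv : ∀ ζ ∈ S, ζ⁻¹ ∈ S)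
    {n : ℕ} (hn : 0 < n) (hpow : ∀ ζ ∈ S, ζ ^ n ∈ S) {F : ℤ[X]} (hF : F.Monic)
    (hFS : F.map (Int.castRingHom ℂ) = ∏ ζ ∈ S, (X - C ζ)) :
    ∃ P : MvPolynomial (Fin 2) ℤ, ∀ x y : ℂ,
      ∏ ζ ∈ S, (x ^ n - ζ * y ^ n) =
        (∏ ζ ∈ S, (x - ζ * y)) * MvPolynomial.aeval ![x + y, x * y] P := by
  have hexp : (expand ℤ n F).map (Int.castRingHom ℂ) = ∏ ζ ∈ S, (X ^ n - C ζ) := by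
    rw [map_expand, hFS, map_prod]
    simp
  have hcard : F.natDegree = S.card := by
    rw [← hF.natDegree_map (Int.castRingHom ℂ), hFS, natDegree_finsetProd_X_sub_C_eq_card]
  obtain ⟨q, hq⟩ : F ∣ expand ℤ n F := by
    rw [← map_dvd_map (Int.castRingHom ℂ) (RingHom.injective_int _) hF, hFS, hexp]
    exact prod_X_sub_C_dvd_prod_X_pow_sub_C hpow
  have hq0 : q ≠ 0 := by
    rintro rfl
    rw [mul_zero, expand_eq_zero hn] at hq
    exact hF.ne_zero hq
  have hdeg : S.card * n = S.card * 1 + q.natDegree := by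
    rw [← hcard, ← natDegree_expand, hq, natDegree_mul hF.ne_zero hq0, mul_one]
  have hle : F.natDegree ≤ S.card * 1 := by rw [hcard, mul_one]
  have hFeval (x y : ℂ) : MvPolynomial.aeval ![x, y] (F.homogenize (S.card * 1)) =
      ∏ ζ ∈ S, (x - ζ * y) := by
    rw [aeval_homogenize_of_map_eq_prod hFS fun ζ _ => natDegree_X_sub_C_le ζ]
    simp
  have hprod (x y : ℂ) : ∏ ζ ∈ S, (x ^ n - ζ * y ^ n) = MvPolynomial.aeval ![x, y]
      (F.homogenize (S.card * 1) * q.homogenize q.natDegree) := by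
    rw [← homogenize_mul _ _ hle le_rfl, ← hq, ← hdeg,
      aeval_homogenize_of_map_eq_prod hexp fun ζ _ => natDegree_X_pow_sub_C.le]
    simp
  obtain ⟨P, hP⟩ := exists_aeval_add_mul_of_isSymmetric (isSymmetric_of_prod_pow_sub_eq h0
    hinv (fun h => hF.ne_zero (eq_zero_of_homogenize_eq_zero hle h)) hFeval hprod)
  exact ⟨P, fun x y => by rw [hprod, map_mul, hFeval, hP]⟩

/-- For a nonempty finite saturated set `Λ` of positive integers and `n ≥ 1`,
there is a two-variable integer polynomial `P` such that for all complex `x, y`: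
`Φ_Λ(xⁿ, yⁿ) = Φ_Λ(x, y) · P(x + y, x·y)`, where
`Φ_Λ(x,y) = ∏_{d ∈ Λ} ∏_{ζ primitive d-th root of unity} (x − ζ·y)`. -/
theorem stmt_12 (n : ℕ) (hn : 0 < n) (Λ : Set ℕ) (hpos : ∀ m ∈ Λ, 0 < m)
    (hne : Λ.Nonempty) (hfin : Λ.Finite)
    (hsat : ∀ h ∈ Λ, ∀ d : ℕ, d ∣ h → d ∈ Λ) :
    ∃ P : MvPolynomial (Fin 2) ℤ, ∀ x y : ℂ,
      (∏ᶠ d ∈ Λ, ∏ ζ ∈ primitiveRoots d ℂ, (x ^ n - ζ * y ^ n)) =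
        (∏ᶠ d ∈ Λ, ∏ ζ ∈ primitiveRoots d ℂ, (x - ζ * y)) *
          MvPolynomial.aeval ![x + y, x * y] P := by
  classical
  set S : Finset ℂ := hfin.toFinset.biUnion fun d => primitiveRoots d ℂ with hS
  have hmem (ζ : ℂ) : ζ ∈ S ↔ ∃ d ∈ Λ, IsPrimitiveRoot ζ d := by
    simp only [hS, Finset.mem_biUnion, Set.Finite.mem_toFinset]
    exact exists_congr fun d => and_congr_right fun hd => mem_primitiveRoots (hpos d hd)
  have hdisj : (hfin.toFinset : Set ℕ).PairwiseDisjoint fun d => primitiveRoots d ℂ :=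
    fun _ _ _ _ h => IsPrimitiveRoot.disjoint h
  simp_rw [finprod_mem_eq_finite_toFinset_prod _ hfin, ← Finset.prod_biUnion hdisj]
  refine exists_prod_pow_sub_eq (F := ∏ d ∈ hfin.toFinset, cyclotomic d ℤ) ?_ ?_ hn ?_
    (monic_prod_of_monic _ _ fun d _ => cyclotomic.monic d ℤ) ?_
  · rw [hmem]
    rintro ⟨d, hd, h⟩
    exact h.ne_zero (hpos d hd).ne' rfl
  · intro ζ hζ
    obtain ⟨d, hd, h⟩ := (hmem ζ).1 hζ
    exact (hmem _).2 ⟨d, hd, h.inv⟩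
  · intro ζ hζ
    obtain ⟨d, hd, h⟩ := (hmem ζ).1 hζ
    refine (hmem _).2 ⟨orderOf (ζ ^ n), hsat d hd _ ?_, IsPrimitiveRoot.orderOf _⟩
    rw [h.eq_orderOf]
    exact orderOf_pow_dvd n
  · rw [Finset.prod_biUnion hdisj, Polynomial.map_prod]
    refine Finset.prod_congr rfl fun d hd => ?_
    have hd0 := hpos d (hfin.mem_toFinset.1 hd)
    rw [map_cyclotomic_int, cyclotomic_eq_prod_X_sub_primitiveRoots
      (Complex.isPrimitiveRoot_exp d hd0.ne')]
end

section
/- Let α and β be complex numbers such that α + β and α·β are integers, and let Λ be a nonempty finite saturated subset of the positive integers with Φ_Λ(α,β) ≠ 0, where Φ_Λ(x,y) := ∏_{d∈Λ} ∏_{ζ primitive d-th root of unity} (x − ζ y). Then for every positive integer n, A_n := Φ_Λ(α^n, β^n)/Φ_Λ(α, β) is an integer, and A_m divides A_n in ℤ whenever m divides n. -/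
open Polynomial

theorem reverse_cyclotomic_int {n : ℕ} (hn : 1 < n) :
    (cyclotomic n ℤ).reverse = cyclotomic n ℤ := by
  have hn0 : 0 < n := by omega
  have hc0 : (cyclotomic n ℤ).coeff 0 = 1 := cyclotomic_coeff_zero ℤ hn
  have htr : (cyclotomic n ℤ).natTrailingDegree = 0 :=
    natTrailingDegree_eq_zero.2 (Or.inr (by rw [hc0]; exact one_ne_zero))
  have hμ := Complex.isPrimitiveRoot_exp n hn0.ne'
  set μ := Complex.exp (2 * Real.pi * Complex.I / n)
  have hμ0 : μ ≠ 0 := hμ.ne_zero hn0.ne'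
  refine eq_of_monic_of_dvd_of_natDegree_le (cyclotomic.monic n ℤ) ?_ ?_
    (reverse_natDegree_le _)
  · rw [Monic, reverse_leadingCoeff, trailingCoeff, htr, hc0]
  · conv_lhs => rw [cyclotomic_eq_minpoly hμ.inv hn0]
    refine minpoly.isIntegrallyClosed_dvd (hμ.inv.isIntegral hn0) ?_
    let _ := invertibleOfNonzero hμ0
    rw [aeval_def, ← invOf_eq_inv μ, eval₂_reverse_eq_zero_iff, ← aeval_def,
      cyclotomic_eq_minpoly hμ hn0]
    exact minpoly.aeval ℤ μ

theorem pow_add_pow_mem_of_add_mem_of_mul_mem {R : Type*} [CommRing R] {S : Subring R} {x y : R}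
    (hadd : x + y ∈ S) (hmul : x * y ∈ S) (n : ℕ) : x ^ n + y ^ n ∈ S := by
  induction n using Nat.twoStepInduction with
  | zero => simpa using S.add_mem S.one_mem S.one_mem
  | one => simpa using hadd
  | more n h0 h1 =>
    have h : x ^ (n + 2) + y ^ (n + 2) =
        (x + y) * (x ^ (n + 1) + y ^ (n + 1)) - x * y * (x ^ n + y ^ n) := by ring
    rw [h]
    exact S.sub_mem (S.mul_mem hadd h1) (S.mul_mem hmul h0)

/-- A binary form with palindromic integer coefficients takes values in any subring containing
the sum and the product of its two arguments. -/
theorem sum_palindromic_mem {R : Type*} [CommRing R] {S : Subring R} {x y : R}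
    (hadd : x + y ∈ S) (hmul : x * y ∈ S) (D : ℕ) (q : ℕ → ℤ)
    (hq : ∀ i ≤ D, q i = q (D - i)) :
    ∑ i ∈ Finset.range (D + 1), (q i : R) * (x ^ i * y ^ (D - i)) ∈ S := by
  induction D using Nat.twoStepInduction generalizing q with
  | zero => simp
  | one =>
    have h1 : q 0 = q 1 := hq 0 (by omega)
    have h : ∑ i ∈ Finset.range (1 + 1), (q i : R) * (x ^ i * y ^ (1 - i)) =
        (q 1 : R) * (x + y) := by
      rw [Finset.sum_range_succ, Finset.sum_range_one, h1]
      simp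
      ring
    rw [h]
    exact S.mul_mem (intCast_mem S _) hadd
  | more D h0 _ =>
    have hmid : ∑ i ∈ Finset.range (D + 1), (q (i + 1) : R) * (x ^ (i + 1) * y ^ (D + 2 - (i + 1)))
        = x * y * ∑ i ∈ Finset.range (D + 1), (q (i + 1) : R) * (x ^ i * y ^ (D - i)) := by
      rw [Finset.mul_sum]
      refine Finset.sum_congr rfl fun i hi => ?_
      have hi' : D + 2 - (i + 1) = (D - i) + 1 := by
        have := Finset.mem_range.1 hi
        omega
      rw [hi']
      ring
    have h : ∑ i ∈ Finset.range (D + 2 + 1), (q i : R) * (x ^ i * y ^ (D + 2 - i)) =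
        x * y * ∑ i ∈ Finset.range (D + 1), (q (i + 1) : R) * (x ^ i * y ^ (D - i)) +
          (q 0 : R) * (x ^ (D + 2) + y ^ (D + 2)) := by
      have h1 : q (D + 2) = q 0 := by simpa using hq (D + 2) le_rfl
      rw [Finset.sum_range_succ, Finset.sum_range_succ', hmid, h1]
      simp
      ring
    rw [h]
    refine S.add_mem (S.mul_mem hmul (h0 (fun i => q (i + 1)) fun i hi => ?_))
      (S.mul_mem (intCast_mem S _) (pow_add_pow_mem_of_add_mem_of_mul_mem hadd hmul _))
    have := hq (i + 1) (by omega)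
    rwa [show D + 2 - (i + 1) = D - i + 1 by omega] at this

theorem prod_primitiveRoots_sub_mul_eq_sum (n : ℕ) (hn : 0 < n) (x y : ℂ) :
    ∏ ζ ∈ primitiveRoots n ℂ, (x - ζ * y) =
      ∑ i ∈ Finset.range (n.totient + 1),
        ((cyclotomic n ℤ).coeff i : ℂ) * (x ^ i * y ^ (n.totient - i)) := by
  have hcard : (primitiveRoots n ℂ).card = n.totient :=
    (Complex.isPrimitiveRoot_exp n hn.ne').card_primitiveRoots
  have hdeg : (cyclotomic n ℂ).natDegree = n.totient := natDegree_cyclotomic n ℂ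
  rcases eq_or_ne y 0 with rfl | hy
  · rw [Finset.sum_range_succ, Finset.sum_eq_zero]
    · have h1 : (cyclotomic n ℤ).coeff n.totient = 1 := by
        have := (cyclotomic.monic n ℤ).coeff_natDegree
        rwa [natDegree_cyclotomic] at this
      simp [hcard, h1]
    · intro i hi
      have : n.totient - i ≠ 0 := by
        have := Finset.mem_range.1 hi
        omega
      simp [this]
  · have h1 : ∏ ζ ∈ primitiveRoots n ℂ, (x - ζ * y) =
        y ^ n.totient * (cyclotomic n ℂ).eval (x / y) := by
      rw [cyclotomic_eq_prod_X_sub_primitiveRoots (Complex.isPrimitiveRoot_exp n hn.ne'),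
        eval_prod, ← hcard, ← Finset.prod_const, ← Finset.prod_mul_distrib]
      refine Finset.prod_congr rfl fun ζ _ => ?_
      simp
      field_simp
    rw [h1, eval_eq_sum_range, hdeg, Finset.mul_sum]
    refine Finset.sum_congr rfl fun i hi => ?_
    have hi' : n.totient = (n.totient - i) + i := by
      have := Finset.mem_range.1 hi
      omega
    rw [← map_cyclotomic_int n ℂ, coeff_map, eq_intCast]
    conv_lhs => rw [hi']
    rw [pow_add, div_pow]
    field_simp

theorem prod_primitiveRoots_sub_mul_mem {S : Subring ℂ} {n : ℕ} (hn : 1 < n) {x y : ℂ}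
    (hadd : x + y ∈ S) (hmul : x * y ∈ S) :
    ∏ ζ ∈ primitiveRoots n ℂ, (x - ζ * y) ∈ S := by
  rw [prod_primitiveRoots_sub_mul_eq_sum n (by omega)]
  refine sum_palindromic_mem hadd hmul _ _ fun i hi => ?_
  conv_lhs => rw [← reverse_cyclotomic_int hn, coeff_reverse, natDegree_cyclotomic, revAt_le hi]

theorem prod_filter_pow_eq_sub_mul {k : ℕ} (hk : 0 < k) {ζ : ℂ} (hζ : ζ ≠ 0) (M : Finset ℂ)
    (hM : ∀ ω : ℂ, ω ^ k = ζ → ω ∈ M) (x y : ℂ) :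
    ∏ ω ∈ M with ω ^ k = ζ, (x - ω * y) = x ^ k - ζ * y ^ k := by
  obtain ⟨ω₀, rfl⟩ := IsAlgClosed.exists_pow_nat_eq ζ hk
  have hω₀ : ω₀ ≠ 0 := by
    rintro rfl
    simp [hk.ne'] at hζ
  rw [← mul_pow, (Complex.isPrimitiveRoot_exp k hk.ne').pow_sub_pow_eq_prod_sub_mul _ _ hk]
  refine Finset.prod_nbij' (fun ω => ω / ω₀) (fun μ => μ * ω₀) ?_ ?_ ?_ ?_ ?_
  · intro ω hω
    rw [mem_nthRootsFinset hk, div_pow, (Finset.mem_filter.1 hω).2,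
      div_self (pow_ne_zero _ hω₀)]
  · intro μ hμ
    rw [mem_nthRootsFinset hk] at hμ
    have h : (μ * ω₀) ^ k = ω₀ ^ k := by rw [mul_pow, hμ, one_mul]
    exact Finset.mem_filter.2 ⟨hM _ h, h⟩
  · intro ω _
    exact div_mul_cancel₀ _ hω₀
  · intro μ _
    exact mul_div_cancel_right₀ _ hω₀
  · intro ω _
    rw [← mul_assoc, div_mul_cancel₀ _ hω₀]

theorem prod_biUnion_primitiveRoots (L : Finset ℕ) (f : ℂ → ℂ) :
    ∏ ζ ∈ L.biUnion (fun d => primitiveRoots d ℂ), f ζ =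
      ∏ d ∈ L, ∏ ζ ∈ primitiveRoots d ℂ, f ζ :=
  Finset.prod_biUnion fun _ _ _ _ h => IsPrimitiveRoot.disjoint h

theorem mem_biUnion_primitiveRoots {L : Finset ℕ} (hL : ∀ d ∈ L, 0 < d) {ζ : ℂ} :
    ζ ∈ L.biUnion (fun d => primitiveRoots d ℂ) ↔ orderOf ζ ∈ L := by
  rw [Finset.mem_biUnion]
  constructor
  · rintro ⟨d, hd, hζ⟩
    rwa [← (isPrimitiveRoot_of_mem_primitiveRoots hζ).eq_orderOf]
  · intro h
    exact ⟨_, h, (mem_primitiveRoots (hL _ h)).2 (IsPrimitiveRoot.orderOf ζ)⟩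

/-- The cyclotomic factorization of `Φ_L(x ^ k, y ^ k)`. -/
theorem prod_primitiveRoots_pow_sub_mul_pow {k : ℕ} (hk : 0 < k) {L E : Finset ℕ}
    (hL : ∀ d ∈ L, 0 < d) (hE : ∀ e, e ∈ E ↔ 0 < e ∧ e / e.gcd k ∈ L) (x y : ℂ) :
    ∏ d ∈ L, ∏ ζ ∈ primitiveRoots d ℂ, (x ^ k - ζ * y ^ k) =
      ∏ e ∈ E, ∏ ω ∈ primitiveRoots e ℂ, (x - ω * y) := by
  have hE0 : ∀ e ∈ E, 0 < e := fun e he => ((hE e).1 he).1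
  have hpow : ∀ ω : ℂ, ω ∈ E.biUnion (fun d => primitiveRoots d ℂ) ↔
      ω ^ k ∈ L.biUnion (fun d => primitiveRoots d ℂ) := by
    intro ω
    rw [mem_biUnion_primitiveRoots hE0, mem_biUnion_primitiveRoots hL, hE,
      orderOf_pow' ω hk.ne']
    refine ⟨fun h => h.2, fun h => ⟨Nat.pos_of_ne_zero fun h0 => ?_, h⟩⟩
    have := hL _ h
    simp [h0] at this
  rw [← prod_biUnion_primitiveRoots, ← prod_biUnion_primitiveRoots,
    ← Finset.prod_fiberwise_of_maps_to (g := fun ω : ℂ => ω ^ k) fun ω hω => (hpow ω).1 hω]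
  refine Finset.prod_congr rfl fun ζ hζ => (prod_filter_pow_eq_sub_mul hk ?_ _ ?_ x y).symm
  · rintro rfl
    have := hL _ ((mem_biUnion_primitiveRoots hL).1 hζ)
    simp at this
  · rintro ω rfl
    exact (hpow ω).2 hζ

/-- If `L` is saturated, `Φ_L(x, y)` divides `Φ_L(x ^ k, y ^ k)` in any subring containing
`x + y` and `x * y`. -/
theorem exists_mem_prod_primitiveRoots_pow_eq_mul {S : Subring ℂ} {L : Finset ℕ}
    (hL : ∀ d ∈ L, 0 < d) (hne : L.Nonempty) (hsat : ∀ h ∈ L, ∀ d : ℕ, d ∣ h → d ∈ L)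
    {x y : ℂ} (hadd : x + y ∈ S) (hmul : x * y ∈ S) {k : ℕ} (hk : 0 < k) :
    ∃ q ∈ S, ∏ d ∈ L, ∏ ζ ∈ primitiveRoots d ℂ, (x ^ k - ζ * y ^ k) =
      q * ∏ d ∈ L, ∏ ζ ∈ primitiveRoots d ℂ, (x - ζ * y) := by
  obtain ⟨E, hE⟩ : ∃ E : Finset ℕ, ∀ e, e ∈ E ↔ 0 < e ∧ e / e.gcd k ∈ L := by
    refine ⟨(L.biUnion fun d => (d * k).divisors).filter fun e => 0 < e ∧ e / e.gcd k ∈ L,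
      fun e => ?_⟩
    rw [Finset.mem_filter, and_iff_right_iff_imp]
    rintro ⟨_, he⟩
    refine Finset.mem_biUnion.2 ⟨_, he, Nat.mem_divisors.2
      ⟨?_, (Nat.mul_pos (hL _ he) hk).ne'⟩⟩
    calc e = e / e.gcd k * e.gcd k := (Nat.div_mul_cancel (Nat.gcd_dvd_left e k)).symm
      _ ∣ e / e.gcd k * k := Nat.mul_dvd_mul_left _ (Nat.gcd_dvd_right e k)
  have hLE : L ⊆ E := fun e he => (hE e).2
    ⟨hL e he, hsat e he _ (Nat.div_dvd_of_dvd (Nat.gcd_dvd_left e k))⟩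
  have h1 : 1 ∈ L := by
    obtain ⟨d, hd⟩ := hne
    exact hsat d hd 1 (one_dvd d)
  refine ⟨∏ e ∈ E \ L, ∏ ζ ∈ primitiveRoots e ℂ, (x - ζ * y), S.prod_mem fun e he => ?_, ?_⟩
  · rw [Finset.mem_sdiff] at he
    have he0 := ((hE e).1 he.1).1
    have he1 : e ≠ 1 := fun h => he.2 (h ▸ h1)
    exact prod_primitiveRoots_sub_mul_mem (by omega) hadd hmul
  · rw [prod_primitiveRoots_pow_sub_mul_pow hk hL hE, Finset.prod_sdiff hLE]

/-- If `α + β` and `α·β` are integers and `Λ` is a nonempty finite saturated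
set of positive integers with `Φ_Λ(α,β) ≠ 0`, then `A_n = Φ_Λ(αⁿ,βⁿ)/Φ_Λ(α,β)` is an integer
for each `n ≥ 1`, and `A_m ∣ A_n` in `ℤ` whenever `m ∣ n`. -/
theorem stmt_13 (α β : ℂ) (ha : ∃ a : ℤ, α + β = (a : ℂ)) (hb : ∃ b : ℤ, α * β = (b : ℂ))
    (Λ : Set ℕ) (hpos : ∀ m ∈ Λ, 0 < m) (hne : Λ.Nonempty) (hfin : Λ.Finite)
    (hsat : ∀ h ∈ Λ, ∀ d : ℕ, d ∣ h → d ∈ Λ)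
    (hΦ : (∏ᶠ d ∈ Λ, ∏ ζ ∈ primitiveRoots d ℂ, (α - ζ * β)) ≠ 0) :
    ∃ A : ℕ → ℤ,
      (∀ n : ℕ, 0 < n →
        ((A n : ℂ)) = (∏ᶠ d ∈ Λ, ∏ ζ ∈ primitiveRoots d ℂ, (α ^ n - ζ * β ^ n)) /
          (∏ᶠ d ∈ Λ, ∏ ζ ∈ primitiveRoots d ℂ, (α - ζ * β))) ∧
      (∀ m n : ℕ, 0 < m → 0 < n → m ∣ n → A m ∣ A n) := by
  obtain ⟨L, rfl⟩ := hfin.exists_finset_coe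
  simp only [Finset.mem_coe] at hpos hsat
  have hne' : L.Nonempty := hne
  simp only [finprod_mem_coe_finset] at hΦ ⊢
  set S : Subring ℂ := (Int.castRingHom ℂ).range
  have hadd : α + β ∈ S := by
    obtain ⟨a, ha⟩ := ha
    exact ⟨a, ha.symm⟩
  have hmul : α * β ∈ S := by
    obtain ⟨b, hb⟩ := hb
    exact ⟨b, hb.symm⟩
  have hA : ∀ n : ℕ, ∃ A : ℤ, 0 < n →
      (A : ℂ) = (∏ d ∈ L, ∏ ζ ∈ primitiveRoots d ℂ, (α ^ n - ζ * β ^ n)) /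
        (∏ d ∈ L, ∏ ζ ∈ primitiveRoots d ℂ, (α - ζ * β)) := by
    intro n
    rcases Nat.eq_zero_or_pos n with rfl | hn
    · exact ⟨0, fun h => absurd h (lt_irrefl 0)⟩
    · obtain ⟨q, ⟨A, rfl⟩, hq⟩ :=
        exists_mem_prod_primitiveRoots_pow_eq_mul hpos hne' hsat hadd hmul hn
      exact ⟨A, fun _ => by rw [hq, mul_div_cancel_right₀ _ hΦ]; rfl⟩
  choose A hA using hA
  refine ⟨A, hA, ?_⟩
  rintro m n hm hn ⟨k, rfl⟩
  have hk : 0 < k := Nat.pos_of_mul_pos_left hn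
  obtain ⟨q, ⟨c, rfl⟩, hq⟩ :=
    exists_mem_prod_primitiveRoots_pow_eq_mul (S := S) (x := α ^ m) (y := β ^ m) hpos hne' hsat
      (pow_add_pow_mem_of_add_mem_of_mul_mem hadd hmul m)
      (by rw [← mul_pow]; exact S.pow_mem hmul m) hk
  refine ⟨c, ?_⟩
  have h : (A (m * k) : ℂ) = ((A m * c : ℤ) : ℂ) := by
    rw [Int.cast_mul, hA _ hn, hA _ hm]
    simp only [pow_mul]
    rw [hq, eq_intCast]
    ring
  exact_mod_cast h
end

section
/- For every positive integer n, the Fibonacci number F_n divides F_{2n}·F_{3n}, the quotient A_n := F_{2n}·F_{3n}/(2·F_n) is an integer (equivalently 2·F_n divides F_{2n}·F_{3n}), and whenever m divides n, A_m divides A_n. (Here A_n = L_n·F_{3n}/2, where L_n = F_{2n}/F_n is the n-th Lucas number; the first values are A_1 = 1, A_2 = 12, A_3 = 68, A_4 = 504.) -/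
theorem fib_two_mul_mul_fib_three_mul (n : ℕ) :
    Nat.fib (2 * n) * Nat.fib (3 * n) =
      Nat.fib n * Nat.lcm (Nat.fib (2 * n)) (Nat.fib (3 * n)) := by
  have h : Nat.gcd (Nat.fib (2 * n)) (Nat.fib (3 * n)) = Nat.fib n := by
    rw [← Nat.fib_gcd, Nat.gcd_mul_right]
    norm_num
  rw [← Nat.gcd_mul_lcm (Nat.fib (2 * n)), h]

theorem two_dvd_lcm_fib (n : ℕ) :
    2 ∣ Nat.lcm (Nat.fib (2 * n)) (Nat.fib (3 * n)) :=
  (Nat.fib_dvd 3 (3 * n) (dvd_mul_right 3 n)).trans (Nat.dvd_lcm_right _ _)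

theorem fib_two_mul_mul_fib_three_mul_div {n : ℕ} (hn : 0 < n) :
    Nat.fib (2 * n) * Nat.fib (3 * n) / (2 * Nat.fib n) =
      Nat.lcm (Nat.fib (2 * n)) (Nat.fib (3 * n)) / 2 := by
  rw [fib_two_mul_mul_fib_three_mul, mul_comm 2 (Nat.fib n),
    Nat.mul_div_mul_left _ _ (Nat.fib_pos.2 hn)]

/-- For every `n ≥ 1`, `F_n ∣ F_{2n}·F_{3n}`, the quotient
`A_n = F_{2n}·F_{3n}/(2·F_n)` is an integer (i.e. `2·F_n ∣ F_{2n}·F_{3n}`), and `A_m ∣ A_n`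
whenever `m ∣ n`. -/
theorem stmt_14 :
    (∀ n : ℕ, 0 < n → Nat.fib n ∣ Nat.fib (2 * n) * Nat.fib (3 * n)) ∧
    (∀ n : ℕ, 0 < n → 2 * Nat.fib n ∣ Nat.fib (2 * n) * Nat.fib (3 * n)) ∧
    (∀ m n : ℕ, 0 < m → 0 < n → m ∣ n →
      (Nat.fib (2 * m) * Nat.fib (3 * m)) / (2 * Nat.fib m) ∣
        (Nat.fib (2 * n) * Nat.fib (3 * n)) / (2 * Nat.fib n)) := by
  refine ⟨fun n _ => ?_, fun n _ => ?_, fun m n hm hn hmn => ?_⟩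
  · rw [fib_two_mul_mul_fib_three_mul]
    exact dvd_mul_right _ _
  · rw [fib_two_mul_mul_fib_three_mul, mul_comm 2 (Nat.fib n)]
    exact mul_dvd_mul_left _ (two_dvd_lcm_fib n)
  · rw [fib_two_mul_mul_fib_three_mul_div hm, fib_two_mul_mul_fib_three_mul_div hn]
    refine Nat.div_dvd_div (two_dvd_lcm_fib m) (lcm_dvd_lcm ?_ ?_)
    · exact Nat.fib_dvd _ _ (mul_dvd_mul_left 2 hmn)
    · exact Nat.fib_dvd _ _ (mul_dvd_mul_left 3 hmn)
end

section
/- Let N_1,…,N_k be pairwise coprime positive integers. For each positive integer n, define S_n := (F_{N_1 n}/F_{N_1})⋯(F_{N_k n}/F_{N_k})/(F_n)^{k−1}, where F denotes the Fibonacci sequence. Then each S_n is a (positive) integer, i.e., (F_n)^{k−1}·F_{N_1}⋯F_{N_k} divides F_{N_1 n}⋯F_{N_k n}, and S_m divides S_n whenever m divides n. -/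
/-- Modulo `F_m`, `F_{Nm+1} ≡ F_{m+1}^N`. -/
theorem fib_mul_add_one_modEq (m N : ℕ) :
    Nat.fib (N * m + 1) ≡ Nat.fib (m + 1) ^ N [MOD Nat.fib m] := by
  induction N with
  | zero => simp [Nat.ModEq]
  | succ N ih =>
    have h : Nat.fib ((N + 1) * m + 1) =
        Nat.fib m * Nat.fib (N * m) + Nat.fib (N * m + 1) * Nat.fib (m + 1) := by
      rw [show (N + 1) * m + 1 = N * m + m + 1 by ring, Nat.fib_add]
      ring
    rw [h, pow_succ]
    simpa using (Nat.modEq_zero_iff_dvd.2 (dvd_mul_right (Nat.fib m) (Nat.fib (N * m)))).add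
      (ih.mul_right (Nat.fib (m + 1)))

/-- Modulo `F_m`, the quotient `F_{Nm} / F_m` satisfies `(F_{Nm} / F_m) F_{m+1} ≡ N F_{m+1}^N`. -/
theorem fib_mul_div_fib_mul_modEq {m : ℕ} (hm : 0 < m) (N : ℕ) :
    Nat.fib (N * m) / Nat.fib m * Nat.fib (m + 1) ≡ N * Nat.fib (m + 1) ^ N [MOD Nat.fib m] := by
  obtain ⟨s, rfl⟩ : ∃ s, m = s + 1 := ⟨m - 1, by omega⟩
  have hF : 0 < Nat.fib (s + 1) := Nat.fib_pos.2 hm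
  induction N with
  | zero => simp [Nat.ModEq]
  | succ N ih =>
    obtain ⟨A, hA⟩ := Nat.fib_dvd (s + 1) (N * (s + 1)) (dvd_mul_left _ _)
    have h : Nat.fib ((N + 1) * (s + 1)) =
        Nat.fib (s + 1) * (A * Nat.fib s + Nat.fib (N * (s + 1) + 1)) := by
      rw [show (N + 1) * (s + 1) = N * (s + 1) + s + 1 by ring, Nat.fib_add, hA]
      ring
    have hs : Nat.fib s ≡ Nat.fib (s + 1 + 1) [MOD Nat.fib (s + 1)] := by
      simp [Nat.fib_add_two, Nat.ModEq]
    rw [hA, Nat.mul_div_cancel_left _ hF] at ih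
    rw [h, Nat.mul_div_cancel_left _ hF]
    have h₁ := (((hs.mul_left A).trans ih).add (fib_mul_add_one_modEq (s + 1) N)).mul_right
      (Nat.fib (s + 1 + 1))
    rwa [← Nat.succ_mul, mul_assoc, ← pow_succ] at h₁

theorem coprime_fib_mul_div_fib {m a b : ℕ} (hm : 0 < m) (hab : Nat.Coprime a b) :
    Nat.Coprime (Nat.fib (a * m) / Nat.fib m) (Nat.fib (b * m) / Nat.fib m) := by
  refine Nat.Coprime.symm (Nat.coprime_of_dvd fun p hp hb ha => ?_)
  have dvd_fib (c : ℕ) (h : p ∣ Nat.fib (c * m) / Nat.fib m) : p ∣ Nat.fib (c * m) :=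
    h.trans (Nat.div_dvd_of_dvd (Nat.fib_dvd _ _ (dvd_mul_left _ _)))
  have hpm : p ∣ Nat.fib m := by
    have h := Nat.dvd_gcd (dvd_fib a ha) (dvd_fib b hb)
    rwa [← Nat.fib_gcd, Nat.gcd_mul_right, hab.gcd_eq_one, one_mul] at h
  have hpm' : ¬ p ∣ Nat.fib (m + 1) := fun h =>
    Nat.not_coprime_of_dvd_of_dvd hp.one_lt hpm h (Nat.fib_coprime_fib_succ m)
  have dvd_index (c : ℕ) (h : p ∣ Nat.fib (c * m) / Nat.fib m) : p ∣ c := by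
    have h₁ := (((fib_mul_div_fib_mul_modEq hm c).of_dvd hpm).dvd_iff dvd_rfl).1
      (h.mul_right _)
    exact (hp.dvd_mul.1 h₁).resolve_right fun h₂ => hpm' (hp.dvd_of_dvd_pow h₂)
  exact Nat.not_coprime_of_dvd_of_dvd hp.one_lt (dvd_index a ha) (dvd_index b hb) hab

/-- For pairwise coprime positive integers `N₁, …, N_k` and
`S_n = (F_{N₁n}/F_{N₁})⋯(F_{N_k n}/F_{N_k})/(F_n)^{k−1}`: each `S_n` (for `n ≥ 1`) is a positive
integer, i.e. `(F_n)^{k−1}·F_{N₁}⋯F_{N_k} ∣ F_{N₁n}⋯F_{N_k n}`, and `S_m ∣ S_n` whenever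
`m ∣ n`. -/
theorem stmt_15 (k : ℕ) (N : Fin k → ℕ) (hpos : ∀ i, 0 < N i)
    (hcop : ∀ i j, i ≠ j → Nat.Coprime (N i) (N j)) :
    (∀ n : ℕ, 0 < n →
      (Nat.fib n) ^ (k - 1) * ∏ i : Fin k, Nat.fib (N i) ∣ ∏ i : Fin k, Nat.fib (N i * n)) ∧
    (∀ n : ℕ, 0 < n →
      0 < (∏ i : Fin k, Nat.fib (N i * n)) / ((Nat.fib n) ^ (k - 1) * ∏ i : Fin k, Nat.fib (N i))) ∧
    (∀ m n : ℕ, 0 < m → 0 < n → m ∣ n →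
      (∏ i : Fin k, Nat.fib (N i * m)) / ((Nat.fib m) ^ (k - 1) * ∏ i : Fin k, Nat.fib (N i)) ∣
        (∏ i : Fin k, Nat.fib (N i * n)) / ((Nat.fib n) ^ (k - 1) * ∏ i : Fin k, Nat.fib (N i))) := by
  rcases k with _ | k
  · simp
  set C := ∏ i, Nat.fib (N i) with hC
  set T : ℕ → ℕ := fun n => Nat.fib n * ∏ i, Nat.fib (N i * n) / Nat.fib n with hT
  have prod_eq (n : ℕ) : ∏ i, Nat.fib (N i * n) = Nat.fib n ^ k * T n := by
    have h (i) : Nat.fib (N i * n) = Nat.fib n * (Nat.fib (N i * n) / Nat.fib n) :=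
      (Nat.mul_div_cancel' (Nat.fib_dvd _ _ (dvd_mul_left _ _))).symm
    rw [Finset.prod_congr rfl fun i _ => h i, Finset.prod_mul_distrib]
    simp [hT, pow_succ, mul_assoc]
  have fib_dvd_T (n : ℕ) (i) : Nat.fib (N i * n) ∣ T n := by
    rw [← Nat.mul_div_cancel' (Nat.fib_dvd n (N i * n) (dvd_mul_left _ _))]
    exact mul_dvd_mul_left _ (Finset.dvd_prod_of_mem _ (Finset.mem_univ i))
  have C_dvd_T (n : ℕ) : C ∣ T n := by
    refine Fintype.prod_dvd_of_isRelPrime (fun i j hij => ?_) fun i =>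
      (Nat.fib_dvd _ _ (dvd_mul_right _ _)).trans (fib_dvd_T n i)
    rw [Function.onFun, ← Nat.coprime_iff_isRelPrime, Nat.Coprime, ← Nat.fib_gcd,
      (hcop i j hij).gcd_eq_one, Nat.fib_one]
  have T_dvd_T {m n : ℕ} (hm : 0 < m) (hmn : m ∣ n) : T m ∣ T n := by
    obtain ⟨U, hU⟩ : Nat.fib m ∣ T n := (Nat.fib_dvd _ _ hmn).trans (dvd_mul_right _ _)
    rw [hU]
    refine mul_dvd_mul_left _ (Fintype.prod_dvd_of_isRelPrime (fun i j hij => ?_) fun i => ?_)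
    · exact Nat.coprime_iff_isRelPrime.1 (coprime_fib_mul_div_fib hm (hcop i j hij))
    · refine Nat.dvd_of_mul_dvd_mul_left (Nat.fib_pos.2 hm) ?_
      rw [← hU, Nat.mul_div_cancel' (Nat.fib_dvd _ _ (dvd_mul_left _ _))]
      exact (Nat.fib_dvd _ _ (mul_dvd_mul_left _ hmn)).trans (fib_dvd_T n i)
  have dvd_prod (n : ℕ) : Nat.fib n ^ k * C ∣ ∏ i, Nat.fib (N i * n) := by
    rw [prod_eq]
    exact mul_dvd_mul_left _ (C_dvd_T n)
  have div_eq {n : ℕ} (hn : 0 < n) :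
      (∏ i, Nat.fib (N i * n)) / (Nat.fib n ^ k * C) = T n / C := by
    rw [prod_eq, Nat.mul_div_mul_left _ _ (pow_pos (Nat.fib_pos.2 hn) k)]
  simp only [Nat.add_sub_cancel]
  refine ⟨fun n _ => dvd_prod n, fun n hn => ?_, fun m n hm hn hmn => ?_⟩
  · have hpos' : 0 < ∏ i, Nat.fib (N i * n) :=
      Finset.prod_pos fun i _ => Nat.fib_pos.2 (Nat.mul_pos (hpos i) hn)
    exact Nat.div_pos (Nat.le_of_dvd hpos' (dvd_prod n)) (Nat.pos_of_dvd_of_pos (dvd_prod n) hpos')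
  · rw [div_eq hm, div_eq hn]
    exact Nat.div_dvd_div (C_dvd_T m) (T_dvd_T hm hmn)
end

section
/- Let Λ be a nonempty finite saturated subset of the positive integers, and for each positive integer n let f_n(x) := Φ_Λ(x^n) = ∏_{d∈Λ} Φ_d(x^n). Then (f_n) is a strong divisibility sequence of polynomials — that is, for all positive integers m and n, the greatest common divisor of f_m and f_n in ℂ[X] is associated to f_{gcd(m,n)} — if and only if Λ = ⟨N⟩ for some positive integer N, i.e., Λ is the set of all positive divisors of a single positive integer N. -/
open Polynomial

theorem eval_finprod_cyclotomic_comp_eq_zero_iff {Λ : Set ℕ} (hpos : ∀ m ∈ Λ, 0 < m)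
    (hfin : Λ.Finite) (n : ℕ) (ζ : ℂ) :
    (∏ᶠ d ∈ Λ, (cyclotomic d ℂ).comp (X ^ n)).eval ζ = 0 ↔
      ∃ d ∈ Λ, IsPrimitiveRoot (ζ ^ n) d := by
  rw [finprod_mem_eq_finite_toFinset_prod _ hfin, eval_prod, Finset.prod_eq_zero_iff]
  refine exists_congr fun d => ?_
  rw [hfin.mem_toFinset]
  refine and_congr_right fun hd => ?_
  rw [eval_comp, eval_pow, eval_X, ← IsRoot.def, isRoot_cyclotomic_iff_charZero (hpos d hd)]

theorem finprod_cyclotomic_comp_of_divisors {N : ℕ} (hN : 0 < N) (n : ℕ) :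
    ∏ᶠ d ∈ {d : ℕ | 0 < d ∧ d ∣ N}, (cyclotomic d ℂ).comp (X ^ n) = (X ^ n) ^ N - 1 := by
  have h : {d : ℕ | 0 < d ∧ d ∣ N} = (N.divisors : Set ℕ) := by
    ext d
    simpa [hN.ne'] using fun h => Nat.pos_of_dvd_of_pos h hN
  rw [h, finprod_mem_coe_finset, ← prod_comp, prod_cyclotomic_eq_X_pow_sub_one hN]
  simp

theorem dvd_pow_gcd_sub_one {R : Type*} [CommRing R] {a x : R} {m n : ℕ}
    (hm : a ∣ x ^ m - 1) (hn : a ∣ x ^ n - 1) : a ∣ x ^ m.gcd n - 1 := by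
  simp only [← Ideal.mem_span_singleton, ← Ideal.Quotient.eq, map_pow, map_one] at *
  exact (pow_gcd_eq_one ..).2 ⟨hm, hn⟩

theorem associated_gcd_pow_sub_one (m n : ℕ) (x : ℂ[X]) :
    Associated (EuclideanDomain.gcd (x ^ m - 1) (x ^ n - 1)) (x ^ m.gcd n - 1) :=
  associated_of_dvd_dvd
    (dvd_pow_gcd_sub_one (EuclideanDomain.gcd_dvd_left _ _) (EuclideanDomain.gcd_dvd_right _ _))
    (EuclideanDomain.dvd_gcd (dvd_pow_sub_one_of_dvd (m.gcd_dvd_left n))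
      (dvd_pow_sub_one_of_dvd (m.gcd_dvd_right n)))

theorem exists_eq_divisors_of_lcm_mem {Λ : Set ℕ} (hpos : ∀ m ∈ Λ, 0 < m) (hne : Λ.Nonempty)
    (hfin : Λ.Finite) (hsat : ∀ h ∈ Λ, ∀ d : ℕ, d ∣ h → d ∈ Λ)
    (hlcm : ∀ a ∈ Λ, ∀ b ∈ Λ, a.lcm b ∈ Λ) :
    ∃ N : ℕ, 0 < N ∧ Λ = {d : ℕ | 0 < d ∧ d ∣ N} := by
  obtain ⟨N, hN, hmax⟩ := hfin.exists_maximalFor id Λ hne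
  refine ⟨N, hpos N hN, Set.ext fun d => ⟨fun hd => ⟨hpos d hd, ?_⟩, fun hd => hsat N hN d hd.2⟩⟩
  have hL := hlcm d hd N hN
  have hle : N ≤ d.lcm N := Nat.le_of_dvd (hpos _ hL) (Nat.dvd_lcm_right d N)
  have heq : d.lcm N = N := le_antisymm (hmax hL hle) hle
  exact heq ▸ Nat.dvd_lcm_left d N

theorem lcm_mem_of_associated_gcd {Λ : Set ℕ} (hpos : ∀ m ∈ Λ, 0 < m) (hfin : Λ.Finite)
    (H : ∀ m n : ℕ, 0 < m → 0 < n →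
      Associated
        (EuclideanDomain.gcd (∏ᶠ d ∈ Λ, (cyclotomic d ℂ).comp (X ^ m))
          (∏ᶠ d ∈ Λ, (cyclotomic d ℂ).comp (X ^ n)))
        (∏ᶠ d ∈ Λ, (cyclotomic d ℂ).comp (X ^ Nat.gcd m n)))
    {a b : ℕ} (ha : a ∈ Λ) (hb : b ∈ Λ) : a.lcm b ∈ Λ := by
  have ha0 := hpos a ha
  have hb0 := hpos b hb
  have hg : 0 < a.gcd b := Nat.gcd_pos_of_pos_left b ha0
  have hL : 0 < a.lcm b := Nat.lcm_pos ha0 hb0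
  have hLa : a.lcm b = b / a.gcd b * a := by
    rw [Nat.lcm, Nat.mul_div_assoc _ (a.gcd_dvd_right b), mul_comm]
  have hLb : a.lcm b = a / a.gcd b * b := by
    rw [Nat.lcm, mul_comm a b, Nat.mul_div_assoc _ (a.gcd_dvd_left b), mul_comm]
  have hζ := Complex.isPrimitiveRoot_exp _ hL.ne'
  set ζ := Complex.exp (2 * Real.pi * Complex.I / (a.lcm b : ℕ))
  have hcop : (b / a.gcd b).gcd (a / a.gcd b) = 1 := (Nat.coprime_div_gcd_div_gcd hg).symm
  have hassoc := H _ _ (Nat.div_pos (Nat.le_of_dvd hb0 (a.gcd_dvd_right b)) hg)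
    (Nat.div_pos (Nat.le_of_dvd ha0 (a.gcd_dvd_left b)) hg)
  rw [hcop] at hassoc
  have hroot := (EuclideanDomain.dvd_gcd
    (dvd_iff_isRoot.2 <| (eval_finprod_cyclotomic_comp_eq_zero_iff hpos hfin _ ζ).2
      ⟨a, ha, hζ.pow hL hLa⟩)
    (dvd_iff_isRoot.2 <| (eval_finprod_cyclotomic_comp_eq_zero_iff hpos hfin _ ζ).2
      ⟨b, hb, hζ.pow hL hLb⟩)).trans hassoc.dvd
  obtain ⟨d, hd, hdζ⟩ :=
    (eval_finprod_cyclotomic_comp_eq_zero_iff hpos hfin _ ζ).1 (dvd_iff_isRoot.1 hroot)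
  rw [pow_one] at hdζ
  exact hζ.unique hdζ ▸ hd

/-- For a nonempty finite saturated set `Λ` of positive integers, the sequence
`f_n(x) = Φ_Λ(xⁿ)` is a strong divisibility sequence of polynomials (i.e. `gcd(f_m, f_n)` is
associated to `f_{gcd(m,n)}`) iff `Λ = ⟨N⟩` is the set of all positive divisors of a single
positive integer `N`. -/
theorem stmt_16 (Λ : Set ℕ) (hpos : ∀ m ∈ Λ, 0 < m) (hne : Λ.Nonempty) (hfin : Λ.Finite)
    (hsat : ∀ h ∈ Λ, ∀ d : ℕ, d ∣ h → d ∈ Λ) :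
    (∀ m n : ℕ, 0 < m → 0 < n →
      Associated
        (EuclideanDomain.gcd (∏ᶠ d ∈ Λ, (cyclotomic d ℂ).comp (X ^ m))
          (∏ᶠ d ∈ Λ, (cyclotomic d ℂ).comp (X ^ n)))
        (∏ᶠ d ∈ Λ, (cyclotomic d ℂ).comp (X ^ Nat.gcd m n))) ↔
    ∃ N : ℕ, 0 < N ∧ Λ = {d : ℕ | 0 < d ∧ d ∣ N} := by
  refine ⟨fun H => exists_eq_divisors_of_lcm_mem hpos hne hfin hsat fun a ha b hb =>
    lcm_mem_of_associated_gcd hpos hfin H ha hb, ?_⟩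
  rintro ⟨N, hN, rfl⟩ m n - -
  simp only [finprod_cyclotomic_comp_of_divisors hN, ← pow_mul, ← Nat.gcd_mul_right]
  exact associated_gcd_pow_sub_one _ _ _
end

section
/- Let Λ be a nonempty finite saturated subset of the positive integers such that for all positive integers m and n, ⟨m⟩Λ ∩ ⟨n⟩Λ = ⟨gcd(m,n)⟩Λ, where ⟨n⟩Λ := {d·e : d ∣ n, e ∈ Λ}. Then for any m, n ∈ Λ, lcm(m,n) ∈ Λ; consequently Λ = ⟨N⟩, the set of all positive divisors of N, where N is the least common multiple of the elements of Λ. -/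
/-- If `Λ` is a nonempty finite saturated set of positive integers such that
`⟨m⟩Λ ∩ ⟨n⟩Λ = ⟨gcd(m,n)⟩Λ` for all positive `m, n`, then `Λ` is closed under `lcm`, and
consequently `Λ = ⟨N⟩` where `N` is the least common multiple of the elements of `Λ`. -/
theorem stmt_17 (Λ : Set ℕ) (hpos : ∀ m ∈ Λ, 0 < m) (hne : Λ.Nonempty) (hfin : Λ.Finite)
    (hsat : ∀ h ∈ Λ, ∀ d : ℕ, d ∣ h → d ∈ Λ)
    (hstr : ∀ m n : ℕ, 0 < m → 0 < n →
      {x : ℕ | ∃ d e : ℕ, d ∣ m ∧ e ∈ Λ ∧ x = d * e} ∩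
          {x : ℕ | ∃ d e : ℕ, d ∣ n ∧ e ∈ Λ ∧ x = d * e} =
        {x : ℕ | ∃ d e : ℕ, d ∣ Nat.gcd m n ∧ e ∈ Λ ∧ x = d * e}) :
    (∀ m ∈ Λ, ∀ n ∈ Λ, Nat.lcm m n ∈ Λ) ∧
    Λ = {d : ℕ | 0 < d ∧ d ∣ hfin.toFinset.lcm id} := by
  have hlcm : ∀ m ∈ Λ, ∀ n ∈ Λ, Nat.lcm m n ∈ Λ := by
    intro m hm n hn
    have hm0 := hpos m hm
    have hn0 := hpos n hn
    have hg : 0 < Nat.gcd m n := Nat.gcd_pos_of_pos_left n hm0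
    have key := hstr (n / Nat.gcd m n) (m / Nat.gcd m n)
      (Nat.div_pos (Nat.gcd_le_right m hn0) hg) (Nat.div_pos (Nat.gcd_le_left n hm0) hg)
    rw [Nat.Coprime.gcd_eq_one (Nat.coprime_div_gcd_div_gcd hg).symm] at key
    have hmem : Nat.lcm m n ∈ {x : ℕ | ∃ d e : ℕ, d ∣ 1 ∧ e ∈ Λ ∧ x = d * e} := by
      rw [← key]
      refine ⟨⟨_, m, dvd_rfl, hm, ?_⟩, ⟨_, n, dvd_rfl, hn, ?_⟩⟩
      · rw [Nat.lcm, Nat.mul_div_assoc _ (Nat.gcd_dvd_right m n), mul_comm]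
      · rw [Nat.lcm, Nat.div_mul_right_comm (Nat.gcd_dvd_left m n)]
    obtain ⟨d, e, hd, he, hx⟩ := hmem
    rw [hx, Nat.dvd_one.mp hd, one_mul]
    exact he
  have hN : hfin.toFinset.lcm id ∈ Λ := by
    obtain ⟨a, ha⟩ := hne
    have hsub : ∀ s : Finset ℕ, (∀ m ∈ s, m ∈ Λ) → s.lcm id ∈ Λ := by
      intro s
      induction s using Finset.induction_on with
      | empty => exact fun _ => by simpa using hsat a ha 1 (one_dvd a)
      | insert b s _ ih =>
        intro hs
        rw [Finset.lcm_insert]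
        exact hlcm b (hs b (Finset.mem_insert_self b s)) _
          (ih fun m hm => hs m (Finset.mem_insert_of_mem hm))
    exact hsub _ fun m hm => hfin.mem_toFinset.mp hm
  refine ⟨hlcm, Set.ext fun d => ⟨fun hd => ⟨hpos d hd, ?_⟩, fun hd => hsat _ hN d hd.2⟩⟩
  exact Finset.dvd_lcm (f := id) (hfin.mem_toFinset.mpr hd)
end
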